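/- arXiv:2404.11625 — 10 statements merged into one kernel-verified Lean document; each statement's English description precedes it below -/
import Mathlib

section
/- Let P be any point on segment BC, let Q be the point on segment AC with PQ parallel to AB, and let R be the point on segment AB with PR parallel to AC. Then the point A_X lies on the circumcircle of triangle AQR; moreover the angle ∠BAA_X equals the angle ∠GAC, where G is the centroid of triangle ABC (i.e., line AA_X is the A-symmedian of triangle ABC). -/
open EuclideanGeometry RealInnerProductSpace

/-- The Euclidean plane. -/
abbrev Pt := EuclideanSpace ℝ (Fin 2)

/-- If `n > 0`, the vector `(n / ‖b‖²) b + (n / ‖c‖²) c` is directed along the symmedian of the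
triangle with sides `b` and `c`. -/
lemma angle_symmedian {V : Type*} [NormedAddCommGroup V] [InnerProductSpace ℝ V]
    {b c x : V} {n u v : ℝ} (hb : b ≠ 0) (hc : c ≠ 0) (hn : 0 < n)
    (hx : x = u • b + v • c) (hu : u * ‖b‖ ^ 2 = n) (hv : v * ‖c‖ ^ 2 = n) :
    InnerProductGeometry.angle b x = InnerProductGeometry.angle (b + c) c := by
  have hb' : 0 < ‖b‖ := norm_pos_iff.2 hb
  have hc' : 0 < ‖c‖ := norm_pos_iff.2 hc
  have hscale : x = (n / (‖b‖ ^ 2 * ‖c‖ ^ 2)) • (‖c‖ ^ 2 • b + ‖b‖ ^ 2 • c) := by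
    have h₁ : u = n / (‖b‖ ^ 2 * ‖c‖ ^ 2) * ‖c‖ ^ 2 := by
      rw [← hu]; field_simp
    have h₂ : v = n / (‖b‖ ^ 2 * ‖c‖ ^ 2) * ‖b‖ ^ 2 := by
      rw [← hv]; field_simp
    rw [hx, smul_add, smul_smul, smul_smul, ← h₁, ← h₂]
  have hnorm : ‖‖c‖ ^ 2 • b + ‖b‖ ^ 2 • c‖ = ‖b‖ * ‖c‖ * ‖b + c‖ := by
    rw [← sq_eq_sq₀ (norm_nonneg _) (by positivity), mul_pow, norm_add_sq_real, norm_add_sq_real]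
    simp only [norm_smul, inner_smul_left, inner_smul_right, norm_pow, norm_norm, conj_trivial]
    ring
  rw [hscale, InnerProductGeometry.angle_smul_right_of_pos _ _ (by positivity),
    InnerProductGeometry.angle, InnerProductGeometry.angle, hnorm]
  congr 1
  simp only [inner_add_left, inner_add_right, inner_smul_right, real_inner_self_eq_norm_sq]
  by_cases h : ‖b + c‖ = 0
  · simp [h]
  · field_simp
    ring

/-- A point of the segment `[A, D]` is `A + r (D - A)` for some real `r`. -/
lemma exists_sub_eq_smul_of_mem_segment {V : Type*} [AddCommGroup V] [Module ℝ V] {A D Y : V}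
    (h : Y ∈ segment ℝ A D) : ∃ r : ℝ, Y - A = r • (D - A) := by
  rw [segment_eq_image'] at h
  obtain ⟨r, -, rfl⟩ := h
  exact ⟨r, add_sub_cancel_left _ _⟩

/-- If `PQ` is parallel to `AB`, then `P - Q` is a multiple of `B - A`. -/
lemma exists_sub_eq_smul_of_parallel {V : Type*} [AddCommGroup V] [Module ℝ V] {A B P Q : V}
    (h : AffineSubspace.Parallel (affineSpan ℝ {P, Q}) (affineSpan ℝ {A, B})) :
    ∃ r : ℝ, P - Q = r • (B - A) := by
  have hmem : P - Q ∈ vectorSpan ℝ ({A, B} : Set V) := by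
    rw [← direction_affineSpan, ← h.direction_eq, direction_affineSpan]
    exact vsub_mem_vectorSpan ℝ (by simp) (by simp)
  obtain ⟨r, hr⟩ := mem_vectorSpan_pair_rev.1 hmem
  exact ⟨r, hr.symm⟩

/-- `Y` lies on the sphere through `A` with centre `O` iff `2 ⟪O - A, Y - A⟫ = ‖Y - A‖²`. -/
lemma dist_eq_dist_iff_two_mul_inner {V : Type*} [NormedAddCommGroup V] [InnerProductSpace ℝ V]
    (O A Y : V) : dist O Y = dist O A ↔ 2 * ⟪O - A, Y - A⟫ = ‖Y - A‖ ^ 2 := by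
  rw [dist_eq_norm, dist_eq_norm, ← sq_eq_sq₀ (norm_nonneg _) (norm_nonneg _),
    ← sub_sub_sub_cancel_right O Y A, norm_sub_sq_real (O - A) (Y - A)]
  constructor <;> intro h <;> linarith

/-- USA TST 2008: with `A_X` the second intersection point (distinct from `A`) of the
circle through `A, B` tangent to line `AC` at `A` with the circle through `A, C` tangent
to line `AB` at `A`, for any `P` on segment `BC`, `Q` on `AC` with `PQ ∥ AB` and `R` on
`AB` with `PR ∥ AC`, the circle `(AQR)` passes through `A_X`, and `∠BAA_X = ∠GAC` where
`G` is the centroid. -/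
theorem stmt_0 (A B C G A_X O₁ O₂ P Q R : Pt)
    (hABC : AffineIndependent ℝ ![A, B, C])
    (hG : G = (3 : ℝ)⁻¹ • (A + B + C))
    -- ω₁ : the circle with center O₁ through A and B, tangent to line AC at A
    (hO₁ : dist O₁ A = dist O₁ B) (hO₁t : ⟪O₁ - A, C - A⟫ = 0)
    -- ω₂ : the circle with center O₂ through A and C, tangent to line AB at A
    (hO₂ : dist O₂ A = dist O₂ C) (hO₂t : ⟪O₂ - A, B - A⟫ = 0)
    -- A_X is the second intersection point of ω₁ and ω₂
    (hX₁ : dist O₁ A_X = dist O₁ A) (hX₂ : dist O₂ A_X = dist O₂ A)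
    (hXA : A_X ≠ A)
    -- P on segment BC
    (hP : P ∈ segment ℝ B C)
    -- Q on segment AC with PQ parallel to AB
    (hQ : Q ∈ segment ℝ A C)
    (hPQ : AffineSubspace.Parallel (affineSpan ℝ {P, Q}) (affineSpan ℝ {A, B}))
    -- R on segment AB with PR parallel to AC
    (hR : R ∈ segment ℝ A B)
    (hPR : AffineSubspace.Parallel (affineSpan ℝ {P, R}) (affineSpan ℝ {A, C})) :
    EuclideanGeometry.Cospherical ({A, Q, R, A_X} : Set Pt) ∧ ∠ B A A_X = ∠ G A C := by
  have hli : LinearIndependent ℝ ![B - A, C - A] := by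
    have h := (affineIndependent_iff_linearIndependent_vsub ℝ ![A, B, C] 0).1 hABC
    have h' := h.comp (fun i : Fin 2 => (⟨i.succ, Fin.succ_ne_zero i⟩ : {x : Fin 3 // x ≠ 0}))
      (fun i j hij => by simpa using hij)
    have e : ![B - A, C - A] = fun i : Fin 2 => ![A, B, C] i.succ -ᵥ ![A, B, C] 0 := by
      ext i : 1
      fin_cases i <;> rfl
    rw [e]
    exact h'
  obtain ⟨q, hq⟩ := exists_sub_eq_smul_of_mem_segment hQ
  obtain ⟨r, hr⟩ := exists_sub_eq_smul_of_mem_segment hR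
  obtain ⟨l, hl⟩ := exists_sub_eq_smul_of_parallel hPQ
  obtain ⟨m, hm⟩ := exists_sub_eq_smul_of_parallel hPR
  obtain ⟨s, hs⟩ := exists_sub_eq_smul_of_mem_segment hP
  have hpair := LinearIndependent.pair_iff.1 hli
  have hqs : q = s := by
    have h := (hpair (l - (1 - s)) (q - s) (by
      linear_combination (norm := module) hs - hl - hq)).2
    linarith
  have hrs : r = 1 - s := by
    have h := (hpair (r - (1 - s)) (m - s) (by
      linear_combination (norm := module) hs - hm - hr)).1
    linarith
  rw [hqs] at hq
  rw [hrs] at hr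
  have hb : B - A ≠ 0 := hli.ne_zero 0
  have hc : C - A ≠ 0 := hli.ne_zero 1
  rw [eq_comm, dist_eq_dist_iff_two_mul_inner] at hO₁ hO₂
  rw [dist_eq_dist_iff_two_mul_inner] at hX₁ hX₂
  constructor
  · refine ⟨A + ((1 - s) • (O₁ - A) + s • (O₂ - A)),
      dist A (A + ((1 - s) • (O₁ - A) + s • (O₂ - A))), ?_⟩
    have key : ∀ Y : Pt, 2 * ((1 - s) * ⟪O₁ - A, Y - A⟫ + s * ⟪O₂ - A, Y - A⟫) = ‖Y - A‖ ^ 2 →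
        dist Y (A + ((1 - s) • (O₁ - A) + s • (O₂ - A))) =
          dist A (A + ((1 - s) • (O₁ - A) + s • (O₂ - A))) := by
      intro Y hY
      rw [dist_comm Y, dist_comm A, dist_eq_dist_iff_two_mul_inner, ← hY, add_sub_cancel_left,
        inner_add_left, real_inner_smul_left, real_inner_smul_left]
    rintro Y (rfl | rfl | rfl | rfl)
    · rfl
    · apply key
      rw [hq, inner_smul_right, inner_smul_right, hO₁t, norm_smul, mul_pow, Real.norm_eq_abs,
        sq_abs, ← hO₂]
      ring
    · apply key
      rw [hr, inner_smul_right, inner_smul_right, hO₂t, norm_smul, mul_pow, Real.norm_eq_abs,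
        sq_abs, ← hO₁]
      ring
    · apply key
      linear_combination (1 - s) * hX₁ + s * hX₂
  · have hspan := hli.span_eq_top_of_card_eq_finrank' (by simp)
    have hmem : A_X - A ∈ Submodule.span ℝ {B - A, C - A} := by
      rw [Matrix.range_cons_cons_empty] at hspan
      simp [hspan]
    obtain ⟨u, v, huv⟩ := Submodule.mem_span_pair.1 hmem
    have hn : 0 < ‖A_X - A‖ ^ 2 := by
      have := norm_pos_iff.2 (sub_ne_zero.2 hXA)
      positivity
    have hu : u * ‖B - A‖ ^ 2 = ‖A_X - A‖ ^ 2 := by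
      rw [← hX₁, ← huv, inner_add_right, inner_smul_right, inner_smul_right, hO₁t, ← hO₁]
      ring
    have hv : v * ‖C - A‖ ^ 2 = ‖A_X - A‖ ^ 2 := by
      rw [← hX₂, ← huv, inner_add_right, inner_smul_right, inner_smul_right, hO₂t, ← hO₂]
      ring
    have hGA : G - A = (3 : ℝ)⁻¹ • ((B - A) + (C - A)) := by
      rw [hG]
      module
    simp only [EuclideanGeometry.angle, vsub_eq_sub]
    rw [hGA, InnerProductGeometry.angle_smul_left_of_pos _ _ (by norm_num)]
    exact angle_symmedian hb hc hn huv.symm hu hv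
end

section
/- The segment OA_X is perpendicular to the segment AA_X, where O is the circumcenter of triangle ABC; that is, A_X is the orthogonal projection of the circumcenter O onto the A-symmedian line of triangle ABC. Equivalently, A_X is the midpoint of the chord AA_S, where A_S is the second intersection point of line AA_X with the circumcircle of ABC. -/
open EuclideanGeometry RealInnerProductSpace

/-- A vector orthogonal to two sides of a nondegenerate triangle in the plane vanishes. -/
theorem eq_zero_of_inner_sides_eq_zero {A B C w : Pt} (hABC : AffineIndependent ℝ ![A, B, C])
    (hB : ⟪w, B - A⟫ = 0) (hC : ⟪w, C - A⟫ = 0) : w = 0 := by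
  have htop : vectorSpan ℝ (Set.range ![A, B, C]) = ⊤ :=
    hABC.vectorSpan_eq_top_of_card_eq_finrank_add_one (by simp)
  have hle : vectorSpan ℝ (Set.range ![A, B, C]) ≤ (ℝ ∙ w)ᗮ := by
    rw [vectorSpan_eq_span_vsub_set_right ℝ (Set.mem_range_self (0 : Fin 3)), Submodule.span_le]
    rintro _ ⟨_, ⟨i, rfl⟩, rfl⟩
    rw [SetLike.mem_coe, Submodule.mem_orthogonal_singleton_iff_inner_right]
    fin_cases i <;> simp [hB, hC]
  have hw : w ∈ (ℝ ∙ w)ᗮ := hle (htop ▸ Submodule.mem_top)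
  exact inner_self_eq_zero.mp (Submodule.mem_orthogonal_singleton_iff_inner_right.mp hw)

/-- The points `Y` and `A` are equidistant from `P` iff the projection of `P - A` on `Y - A`
is half of `Y - A`. -/
theorem dist_eq_dist_iff_two_mul_inner_s2 (P A Y : Pt) :
    dist P A = dist P Y ↔ 2 * ⟪P - A, Y - A⟫ = ⟪Y - A, Y - A⟫ := by
  rw [← sq_eq_sq₀ dist_nonneg dist_nonneg, dist_eq_norm, dist_eq_norm,
    ← sub_sub_sub_cancel_right P Y A, norm_sub_sq_real (P - A), real_inner_self_eq_norm_sq]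
  constructor <;> intro h <;> linarith

/-- `A_X` is the orthogonal projection of the circumcenter `O` of triangle `ABC` onto the
`A`-symmedian line of the triangle: `OA_X ⊥ AA_X`; equivalently `A_X` is the midpoint of
the chord `AA_S`, where `A_S` is the second intersection of line `AA_X` with the
circumcircle. -/
theorem stmt_2 (A B C O A_X O₁ O₂ : Pt)
    (hABC : AffineIndependent ℝ ![A, B, C])
    -- O is the circumcenter of triangle ABC
    (hOA : dist O A = dist O B) (hOB : dist O B = dist O C)
    -- ω₁ : the circle with center O₁ through A and B, tangent to line AC at A
    (hO₁ : dist O₁ A = dist O₁ B) (hO₁t : ⟪O₁ - A, C - A⟫ = 0)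
    -- ω₂ : the circle with center O₂ through A and C, tangent to line AB at A
    (hO₂ : dist O₂ A = dist O₂ C) (hO₂t : ⟪O₂ - A, B - A⟫ = 0)
    -- A_X is the second intersection point of ω₁ and ω₂
    (hX₁ : dist O₁ A_X = dist O₁ A) (hX₂ : dist O₂ A_X = dist O₂ A)
    (hXA : A_X ≠ A) :
    ⟪O - A_X, A - A_X⟫ = 0 ∧
      ∀ A_S : Pt, A_S ≠ A → Collinear ℝ ({A, A_X, A_S} : Set Pt) →
        dist O A_S = dist O A → A_X = midpoint ℝ A A_S := by
  rw [dist_eq_dist_iff_two_mul_inner_s2] at hOA hO₁ hO₂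
  have hOC : dist O A = dist O C :=
    ((dist_eq_dist_iff_two_mul_inner_s2 O A B).mpr hOA).trans hOB
  rw [dist_eq_dist_iff_two_mul_inner_s2] at hOC
  rw [eq_comm, dist_eq_dist_iff_two_mul_inner_s2] at hX₁ hX₂
  have hsum : (O - A) - (O₁ - A) - (O₂ - A) = 0 := by
    apply eq_zero_of_inner_sides_eq_zero hABC <;> rw [inner_sub_left, inner_sub_left] <;> linarith
  have hproj : ⟪O - A, A_X - A⟫ = ⟪A_X - A, A_X - A⟫ := by
    have h : ⟪(O - A) - (O₁ - A) - (O₂ - A), A_X - A⟫ = 0 := by rw [hsum, inner_zero_left]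
    rw [inner_sub_left, inner_sub_left] at h
    linarith
  refine ⟨?_, fun A_S hSA hcol hS => ?_⟩
  · rw [← sub_sub_sub_cancel_right O A_X A, ← neg_sub A_X A, inner_neg_right, inner_sub_left,
      hproj, sub_self, neg_zero]
  · obtain ⟨r, hr⟩ : ∃ r : ℝ, A_S = r • (A_X - A) + A := by
      have hmem := hcol.mem_affineSpan_of_mem_of_ne (p₁ := A) (p₂ := A_X) (p₃ := A_S)
        (by simp) (by simp) (by simp) hXA.symm
      obtain ⟨r, rfl⟩ := mem_affineSpan_pair_iff_exists_lineMap_eq.mp hmem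
      exact ⟨r, by simp [AffineMap.lineMap_apply]⟩
    rw [eq_comm, dist_eq_dist_iff_two_mul_inner_s2, hr, add_sub_cancel_right, real_inner_smul_right,
      real_inner_smul_right, real_inner_smul_left, hproj] at hS
    have hr0 : r ≠ 0 := by
      rintro rfl
      simp [hr] at hSA
    have hX0 : ⟪A_X - A, A_X - A⟫ ≠ 0 := inner_self_ne_zero.mpr (sub_ne_zero.mpr hXA)
    have hr2 : r = 2 := by
      apply mul_right_cancel₀ (mul_ne_zero hr0 hX0)
      linarith
    rw [hr, hr2, eq_comm, midpoint_eq_iff, AffineEquiv.pointReflection_apply, vsub_eq_sub,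
      vadd_eq_add, two_smul]
    abel
end

section
/- The three points A_X, B_X, C_X all lie on the circle with diameter OL (the Brocard circle of triangle ABC), where O is the circumcenter and L is the Lemoine (symmedian) point of triangle ABC. -/
open EuclideanGeometry RealInnerProductSpace

/-- Vectors of a real inner product space: if `y u + z v` with `z > 0` makes the same angle with
`u` as the median vector `u + v` makes with `v`, then it is parallel to the symmedian vector
`‖v‖² u + ‖u‖² v`. -/
lemma mul_normSq_eq_of_angle_eq {V : Type*} [NormedAddCommGroup V] [InnerProductSpace ℝ V]
    {u v : V} {r y z : ℝ} (hr : 0 < r) (hz : 0 < z)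
    (hΓ : 0 < ⟪u, u⟫ * ⟪v, v⟫ - ⟪u, v⟫ ^ 2)
    (h : InnerProductGeometry.angle (y • u + z • v) u =
      InnerProductGeometry.angle (r • (u + v)) v) :
    y * ⟪u, u⟫ = z * ⟪v, v⟫ := by
  rw [InnerProductGeometry.angle_smul_left_of_pos _ _ hr] at h
  have hcos := congrArg Real.cos h
  rw [InnerProductGeometry.cos_angle, InnerProductGeometry.cos_angle] at hcos
  set p := ⟪y • u + z • v, u⟫ with hp
  set q := ⟪u + v, v⟫ with hq
  have hp' : p = y * ⟪u, u⟫ + z * ⟪u, v⟫ := by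
    rw [hp, inner_add_left, real_inner_smul_left, real_inner_smul_left, real_inner_comm u v]
  have hq' : q = ⟪u, v⟫ + ⟪v, v⟫ := by rw [hq, inner_add_left]
  set s := ‖y • u + z • v‖ * ‖u‖ with hs
  set t := ‖u + v‖ * ‖v‖ with ht
  have hs2 : s ^ 2 = p ^ 2 + z ^ 2 * (⟪u, u⟫ * ⟪v, v⟫ - ⟪u, v⟫ ^ 2) := by
    rw [hp', hs, mul_pow, ← real_inner_self_eq_norm_sq, ← real_inner_self_eq_norm_sq]
    simp only [inner_add_left, inner_add_right, real_inner_smul_left, real_inner_smul_right,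
      real_inner_comm u v]
    ring
  have ht2 : t ^ 2 = q ^ 2 + (⟪u, u⟫ * ⟪v, v⟫ - ⟪u, v⟫ ^ 2) := by
    rw [hq', ht, mul_pow, ← real_inner_self_eq_norm_sq, ← real_inner_self_eq_norm_sq]
    simp only [inner_add_left, inner_add_right, real_inner_comm u v]
    ring
  have hs0 : 0 < s := lt_of_le_of_ne (by positivity) fun h0 => by
    rw [← h0] at hs2
    nlinarith [sq_nonneg p, mul_pos (pow_pos hz 2) hΓ]
  have ht0 : 0 < t := lt_of_le_of_ne (by positivity) fun h0 => by
    rw [← h0] at ht2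
    nlinarith [sq_nonneg q]
  rw [div_eq_div_iff hs0.ne' ht0.ne'] at hcos
  have hsq : p ^ 2 = (z * q) ^ 2 := by
    have h2 : p ^ 2 * t ^ 2 = q ^ 2 * s ^ 2 := by rw [← mul_pow, hcos, mul_pow]
    rw [hs2, ht2] at h2
    refine mul_right_cancel₀ hΓ.ne' ?_
    linear_combination h2
  have hpq : p = z * q := by
    rcases sq_eq_sq_iff_eq_or_eq_neg.mp hsq with h1 | h1
    · exact h1
    · have h3 : q * (s + z * t) = 0 := by rw [h1] at hcos; linear_combination -hcos
      have hq0 : q = 0 := (mul_eq_zero.mp h3).resolve_right (by positivity)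
      rw [h1, hq0]; simp
  rw [hp', hq'] at hpq
  linear_combination hpq

/-- Twice the signed area of the triangle `ABC`. -/
def signedArea (A B C : Pt) : ℝ :=
  (B 0 - A 0) * (C 1 - A 1) - (B 1 - A 1) * (C 0 - A 0)

lemma signedArea_rotate (A B C : Pt) : signedArea B C A = signedArea A B C := by
  simp only [signedArea]; ring

lemma signedArea_ne_zero {A B C : Pt} (h : AffineIndependent ℝ ![A, B, C]) :
    signedArea A B C ≠ 0 := by
  intro h0
  have hdep : ¬ Collinear ℝ {A, B, C} := (affineIndependent_iff_not_collinear_set).mp h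
  refine hdep ?_
  by_cases hAB : A = B
  · subst hAB; simpa using collinear_pair ℝ A C
  rw [collinear_iff_of_mem (Set.mem_insert A _)]
  refine ⟨B - A, ?_⟩
  have hcoord : B 0 - A 0 ≠ 0 ∨ B 1 - A 1 ≠ 0 := by
    by_contra! hc
    refine hAB ?_
    ext i
    fin_cases i
    · exact (sub_eq_zero.mp hc.1).symm
    · exact (sub_eq_zero.mp hc.2).symm
  have hC : ∃ r : ℝ, C = r • (B - A) +ᵥ A := by
    simp only [signedArea] at h0
    rcases hcoord with hc | hc
    · refine ⟨(C 0 - A 0) / (B 0 - A 0), ?_⟩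
      ext i
      fin_cases i
      · simp [div_mul_cancel₀ _ hc]
      · simp; field_simp; linear_combination h0
    · refine ⟨(C 1 - A 1) / (B 1 - A 1), ?_⟩
      ext i
      fin_cases i
      · simp; field_simp; linear_combination -h0
      · simp [div_mul_cancel₀ _ hc]
  rintro p (rfl | rfl | rfl)
  · exact ⟨0, by simp⟩
  · exact ⟨1, by simp⟩
  · exact hC

lemma real_inner_eq_coord (u v : Pt) : ⟪u, v⟫ = u 0 * v 0 + u 1 * v 1 := by
  simp [PiLp.inner_apply, Fin.sum_univ_two, mul_comm]

lemma dist_eq_dist_iff_inner (P Q R S : Pt) :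
    dist P Q = dist R S ↔ ⟪P - Q, P - Q⟫ = ⟪R - S, R - S⟫ := by
  rw [real_inner_self_eq_norm_sq, real_inner_self_eq_norm_sq, ← dist_eq_norm, ← dist_eq_norm,
    sq_eq_sq₀ dist_nonneg dist_nonneg]

/-- The angle condition for the isogonal conjugate of the centroid, in barycentric coordinates. -/
lemma barycentric_of_angle_eq {A B C G L : Pt} {x y z : ℝ} (hD : signedArea A B C ≠ 0)
    (hG : G = (3 : ℝ)⁻¹ • (A + B + C)) (hxyz : x + y + z = 1)
    (hL : L = x • A + y • B + z • C) (h : ∠ L A B = ∠ G A C) (hz : 0 < z) :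
    y * ⟪B - A, B - A⟫ = z * ⟪C - A, C - A⟫ := by
  refine mul_normSq_eq_of_angle_eq (r := (3 : ℝ)⁻¹) (by norm_num) hz ?_ ?_
  · have : ⟪B - A, B - A⟫ * ⟪C - A, C - A⟫ - ⟪B - A, C - A⟫ ^ 2 = signedArea A B C ^ 2 := by
      simp only [real_inner_eq_coord, signedArea, PiLp.sub_apply]; ring
    rw [this]; positivity
  · have hx : x = 1 - y - z := by linarith
    have h1 : y • (B - A) + z • (C - A) = L -ᵥ A := by
      rw [hL, hx, vsub_eq_sub]; module
    have h2 : (3 : ℝ)⁻¹ • ((B - A) + (C - A)) = G -ᵥ A := by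
      rw [hG, vsub_eq_sub]; module
    rw [h1, h2]
    exact h

lemma exists_barycentric {A B C : Pt} (hD : signedArea A B C ≠ 0) (L : Pt) :
    ∃ x y z : ℝ, x + y + z = 1 ∧ L = x • A + y • B + z • C := by
  refine ⟨1 - signedArea A L C / signedArea A B C - signedArea A B L / signedArea A B C,
    signedArea A L C / signedArea A B C, signedArea A B L / signedArea A B C, by ring, ?_⟩
  ext i
  fin_cases i <;> simp <;> field_simp <;> simp only [signedArea] <;> ring

/-- The second intersection `P` of the two circles through `A` and `B`, respectively `A` and `C`,
tangent at `A` to the other side, sees the segment from the circumcenter to any point of the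
symmedian from `A` under a right angle. -/
lemma inner_eq_zero_of_mem_symmedian {A B C O L P O₁ O₂ : Pt} {x y z : ℝ}
    (hD : signedArea A B C ≠ 0) (hOB : dist O A = dist O B) (hOC : dist O A = dist O C)
    (hxyz : x + y + z = 1) (hL : L = x • A + y • B + z • C)
    (hyz : y * ⟪B - A, B - A⟫ = z * ⟪C - A, C - A⟫)
    (hO₁ : dist O₁ A = dist O₁ B) (hO₁t : ⟪O₁ - A, C - A⟫ = 0)
    (hO₂ : dist O₂ A = dist O₂ C) (hO₂t : ⟪O₂ - A, B - A⟫ = 0)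
    (hP₁ : dist O₁ P = dist O₁ A) (hP₂ : dist O₂ P = dist O₂ A) (hP : P ≠ A) :
    ⟪L - P, O - P⟫ = 0 := by
  have hx : x = 1 - y - z := by linarith
  have hL' : L - A = y • (B - A) + z • (C - A) := by rw [hL, hx]; module
  rw [dist_eq_dist_iff_inner] at hOB hOC hO₁ hO₂ hP₁ hP₂
  have hPA : P - A ≠ 0 := sub_ne_zero.mpr hP
  rw [show L - P = (L - A) - (P - A) by abel, show O - P = (O - A) - (P - A) by abel, hL']
  rw [show O - B = (O - A) - (B - A) by abel] at hOB
  rw [show O - C = (O - A) - (C - A) by abel] at hOC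
  rw [show O₁ - B = (O₁ - A) - (B - A) by abel] at hO₁
  rw [show O₂ - C = (O₂ - A) - (C - A) by abel] at hO₂
  rw [show O₁ - P = (O₁ - A) - (P - A) by abel] at hP₁
  rw [show O₂ - P = (O₂ - A) - (P - A) by abel] at hP₂
  have hD' : (B - A) 0 * (C - A) 1 - (B - A) 1 * (C - A) 0 ≠ 0 := hD
  generalize B - A = u at *
  generalize C - A = v at *
  generalize P - A = p at *
  generalize O - A = o at *
  generalize O₁ - A = m at *
  generalize O₂ - A = n at *
  have hp : p 0 ≠ 0 ∨ p 1 ≠ 0 := by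
    by_contra! hc
    refine hPA ?_
    ext i
    fin_cases i
    exacts [hc.1, hc.2]
  simp only [real_inner_eq_coord, PiLp.sub_apply, PiLp.add_apply, PiLp.smul_apply,
    smul_eq_mul] at *
  generalize u 0 = u0 at *
  generalize u 1 = u1 at *
  generalize v 0 = v0 at *
  generalize v 1 = v1 at *
  generalize p 0 = p0 at *
  generalize p 1 = p1 at *
  generalize o 0 = o0 at *
  generalize o 1 = o1 at *
  generalize m 0 = m0 at *
  generalize m 1 = m1 at *
  generalize n 0 = n0 at *
  generalize n 1 = n1 at *
  have ho0 : o0 = m0 + n0 := by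
    refine mul_right_cancel₀ hD' ?_
    linear_combination (v1 * (hOB - hO₁ - 2 * hO₂t) - u1 * (hOC - hO₂ - 2 * hO₁t)) / 2
  have ho1 : o1 = m1 + n1 := by
    refine mul_right_cancel₀ hD' ?_
    linear_combination (-v0 * (hOB - hO₁ - 2 * hO₂t) + u0 * (hOC - hO₂ - 2 * hO₁t)) / 2
  have hop : p0 * (o0 - p0) + p1 * (o1 - p1) = 0 := by
    rw [ho0, ho1]; linear_combination -(hP₁ + hP₂) / 2
  have hd : (m0 - n0) * p0 + (m1 - n1) * p1 = 0 := by linear_combination (hP₂ - hP₁) / 2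
  set w0 := y * u0 + z * v0
  set w1 := y * u1 + z * v1
  have hdw : (m0 - n0) * w0 + (m1 - n1) * w1 = 0 := by
    linear_combination y * hO₁ / 2 - z * hO₂ / 2 + z * hO₁t - y * hO₂t + hyz / 2
  have hmn : m0 - n0 ≠ 0 ∨ m1 - n1 ≠ 0 := by
    by_contra! hc
    have hu : u0 ^ 2 + u1 ^ 2 = 0 := by
      linear_combination -hO₁ + 2 * u0 * hc.1 + 2 * u1 * hc.2 + 2 * hO₂t
    have h0 := (add_eq_zero_iff_of_nonneg (sq_nonneg u0) (sq_nonneg u1)).mp hu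
    exact hD' (by rw [sq_eq_zero_iff.mp h0.1, sq_eq_zero_iff.mp h0.2]; ring)
  have hcross : w0 * p1 - w1 * p0 = 0 := by
    rcases hmn with h | h <;> refine mul_left_cancel₀ h ?_
    · linear_combination p1 * hdw - w1 * hd
    · linear_combination w0 * hd - p0 * hdw
  rcases hp with h | h <;> refine mul_left_cancel₀ h ?_
  · linear_combination (w0 - p0) * hop - (o1 - p1) * hcross
  · linear_combination (w1 - p1) * hop + (o0 - p0) * hcross

/-- Thales' theorem. -/
lemma dist_midpoint_eq_of_inner_eq_zero {O L P : Pt} (h : ⟪L - P, O - P⟫ = 0) :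
    dist (midpoint ℝ O L) P = dist O L / 2 := by
  rw [dist_eq_norm, dist_eq_norm]
  have h1 : midpoint ℝ O L - P = (2 : ℝ)⁻¹ • ((L - P) + (O - P)) := by
    rw [midpoint_eq_smul_add, invOf_eq_inv]; module
  have h2 : ‖(L - P) + (O - P)‖ = ‖(L - P) - (O - P)‖ := by
    rw [← sq_eq_sq₀ (norm_nonneg _) (norm_nonneg _), norm_add_sq_real,
      norm_sub_sq_real (L - P), h]
    ring
  rw [h1, norm_smul, h2, sub_sub_sub_cancel_right, norm_sub_rev]
  norm_num
  ring

/-- The points `A_X`, `B_X`, `C_X` (the second Brocard triangle) lie on the circle with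
diameter `OL` (the Brocard circle), where `O` is the circumcenter and `L` the Lemoine
point of triangle `ABC`. -/
theorem stmt_3 (A B C O G L A_X B_X C_X O₁ O₂ Q₁ Q₂ R₁ R₂ : Pt)
    (hABC : AffineIndependent ℝ ![A, B, C])
    -- O is the circumcenter of triangle ABC
    (hOA : dist O A = dist O B) (hOB : dist O B = dist O C)
    -- G is the centroid of triangle ABC
    (hG : G = (3 : ℝ)⁻¹ • (A + B + C))
    -- L is the Lemoine (symmedian) point: the isogonal conjugate of G
    (hL₁ : ∠ L A B = ∠ G A C) (hL₂ : ∠ L B C = ∠ G B A) (hL₃ : ∠ L C A = ∠ G C B)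
    -- A_X : second intersection (≠ A) of the circle through A, B tangent to AC at A
    -- with the circle through A, C tangent to AB at A
    (hO₁ : dist O₁ A = dist O₁ B) (hO₁t : ⟪O₁ - A, C - A⟫ = 0)
    (hO₂ : dist O₂ A = dist O₂ C) (hO₂t : ⟪O₂ - A, B - A⟫ = 0)
    (hAX₁ : dist O₁ A_X = dist O₁ A) (hAX₂ : dist O₂ A_X = dist O₂ A)
    (hAX : A_X ≠ A)
    -- B_X : second intersection (≠ B) of the circle through B, C tangent to BA at B
    -- with the circle through B, A tangent to BC at B
    (hQ₁ : dist Q₁ B = dist Q₁ C) (hQ₁t : ⟪Q₁ - B, A - B⟫ = 0)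
    (hQ₂ : dist Q₂ B = dist Q₂ A) (hQ₂t : ⟪Q₂ - B, C - B⟫ = 0)
    (hBX₁ : dist Q₁ B_X = dist Q₁ B) (hBX₂ : dist Q₂ B_X = dist Q₂ B)
    (hBX : B_X ≠ B)
    -- C_X : second intersection (≠ C) of the circle through C, A tangent to CB at C
    -- with the circle through C, B tangent to CA at C
    (hR₁ : dist R₁ C = dist R₁ A) (hR₁t : ⟪R₁ - C, B - C⟫ = 0)
    (hR₂ : dist R₂ C = dist R₂ B) (hR₂t : ⟪R₂ - C, A - C⟫ = 0)
    (hCX₁ : dist R₁ C_X = dist R₁ C) (hCX₂ : dist R₂ C_X = dist R₂ C)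
    (hCX : C_X ≠ C) :
    dist (midpoint ℝ O L) A_X = dist O L / 2 ∧
      dist (midpoint ℝ O L) B_X = dist O L / 2 ∧
        dist (midpoint ℝ O L) C_X = dist O L / 2 := by
  have hD := signedArea_ne_zero hABC
  have hD' : signedArea B C A ≠ 0 := by rwa [signedArea_rotate]
  have hD'' : signedArea C A B ≠ 0 := by rwa [signedArea_rotate]
  obtain ⟨x, y, z, hxyz, hL⟩ := exists_barycentric hD L
  have hA := barycentric_of_angle_eq hD hG hxyz hL hL₁
  have hyzx : y + z + x = 1 := by linarith
  have hLB : L = y • B + z • C + x • A := by rw [hL]; abel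
  have hB := barycentric_of_angle_eq hD' (by rw [hG]; congr 1; abel) hyzx hLB hL₂
  have hzxy : z + x + y = 1 := by linarith
  have hLC : L = z • C + x • A + y • B := by rw [hL]; abel
  have hC := barycentric_of_angle_eq hD'' (by rw [hG]; congr 1; abel) hzxy hLC hL₃
  have hAB : 0 < ⟪B - A, B - A⟫ := real_inner_self_pos.mpr <| sub_ne_zero.mpr fun h =>
    hD (by simp [signedArea, h])
  have hBC : 0 < ⟪C - B, C - B⟫ := real_inner_self_pos.mpr <| sub_ne_zero.mpr fun h =>
    hD' (by simp [signedArea, h])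
  have hCA : 0 < ⟪A - C, A - C⟫ := real_inner_self_pos.mpr <| sub_ne_zero.mpr fun h =>
    hD'' (by simp [signedArea, h])
  have hAC : 0 < ⟪C - A, C - A⟫ := by rwa [← neg_sub A C, inner_neg_neg]
  have hBA : 0 < ⟪A - B, A - B⟫ := by rwa [← neg_sub B A, inner_neg_neg]
  have hCB : 0 < ⟪B - C, B - C⟫ := by rwa [← neg_sub C B, inner_neg_neg]
  have hzy (h : 0 < z) : 0 < y := pos_of_mul_pos_left (hA h ▸ mul_pos h hAC) hAB.le
  have hxz (h : 0 < x) : 0 < z := pos_of_mul_pos_left (hB h ▸ mul_pos h hBA) hBC.le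
  have hyx (h : 0 < y) : 0 < x := pos_of_mul_pos_left (hC h ▸ mul_pos h hCB) hCA.le
  have hx : 0 < x := by
    by_contra hx
    have hy : ¬ 0 < y := fun h => hx (hyx h)
    have hz : ¬ 0 < z := fun h => hy (hzy h)
    linarith
  have hz := hxz hx
  have hy := hzy hz
  exact ⟨dist_midpoint_eq_of_inner_eq_zero <| inner_eq_zero_of_mem_symmedian hD hOA
      (hOA.trans hOB) hxyz hL (hA hz) hO₁ hO₁t hO₂ hO₂t hAX₁ hAX₂ hAX,
    dist_midpoint_eq_of_inner_eq_zero <| inner_eq_zero_of_mem_symmedian hD' hOB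
      hOA.symm hyzx hLB (hB hx) hQ₁ hQ₁t hQ₂ hQ₂t hBX₁ hBX₂ hBX,
    dist_midpoint_eq_of_inner_eq_zero <| inner_eq_zero_of_mem_symmedian hD''
      (hOA.trans hOB).symm hOB.symm hzxy hLC (hC hy) hR₁ hR₁t hR₂ hR₂t hCX₁ hCX₂ hCX⟩
end

section
/- Let P be a point that is not a vertex of triangle ABC, and let the lines AP, BP, CP meet the circumcircle of ABC again at S, T, U respectively. Let X, Y, Z be the midpoints of segments AS, BT, CU respectively. Then X, Y, Z all lie on the circle with diameter OP, where O is the circumcenter of triangle ABC. -/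
open EuclideanGeometry RealInnerProductSpace

/-- A point whose connecting segments to `O` and `P` are perpendicular lies on the circle with
diameter `OP`. -/
theorem dist_midpoint_eq_half_dist_of_inner_eq_zero {V : Type*} [NormedAddCommGroup V]
    [InnerProductSpace ℝ V] {O P X : V} (h : inner ℝ (X - O) (X - P) = 0) :
    dist (midpoint ℝ O P) X = dist O P / 2 := by
  have hm : midpoint ℝ O P - X = -((2⁻¹ : ℝ) • ((X - P) + (X - O))) := by
    rw [midpoint_eq_smul_add, invOf_eq_inv]
    module
  have hs : O - P = (X - P) - (X - O) := by abel
  rw [dist_eq_norm, dist_eq_norm, hm, hs, norm_sub_eq_norm_add h, norm_neg, norm_smul]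
  norm_num
  ring

/-- If a line through `P` cuts a circle with center `O` in the chord `AS`, then the midpoint of
the chord lies on the circle with diameter `OP`. -/
theorem dist_midpoint_midpoint_of_collinear {V : Type*} [NormedAddCommGroup V]
    [InnerProductSpace ℝ V] {O P A S : V} (hS : dist O S = dist O A)
    (hl : Collinear ℝ ({A, P, S} : Set V)) (hSA : S ≠ A) :
    dist (midpoint ℝ O P) (midpoint ℝ A S) = dist O P / 2 := by
  apply dist_midpoint_eq_half_dist_of_inner_eq_zero
  have hP : P ∈ line[ℝ, A, S] :=
    hl.mem_affineSpan_of_mem_of_ne (by simp) (by simp) (by simp) hSA.symm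
  obtain ⟨t, rfl⟩ := mem_affineSpan_pair_iff_exists_lineMap_eq.mp hP
  have hperp : inner ℝ (midpoint ℝ A S - O) (S - A) = 0 := by
    have h := EuclideanGeometry.inner_vsub_vsub_of_dist_eq_of_dist_eq
      (c₁ := O) (c₂ := midpoint ℝ A S) (p₁ := A) (p₂ := S)
      (by rw [dist_comm, ← hS, dist_comm]) (by simp)
    simpa using h
  have hd : midpoint ℝ A S - AffineMap.lineMap A S t = (2⁻¹ - t) • (S - A) := by
    rw [midpoint_eq_smul_add, invOf_eq_inv, AffineMap.lineMap_apply_module]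
    module
  rw [hd, inner_smul_right, hperp, mul_zero]

/-- If the lines `AP`, `BP`, `CP` meet the circumcircle of `ABC` (center `O`) again at
`S`, `T`, `U`, then the midpoints `X`, `Y`, `Z` of `AS`, `BT`, `CU` lie on the circle
with diameter `OP`. -/
theorem stmt_5 (A B C O P S T U X Y Z : Pt)
    (hABC : AffineIndependent ℝ ![A, B, C])
    -- O is the circumcenter of triangle ABC
    (hOA : dist O A = dist O B) (hOB : dist O B = dist O C)
    -- P is not a vertex of triangle ABC
    (hPA : P ≠ A) (hPB : P ≠ B) (hPC : P ≠ C)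
    -- S is the second intersection of line AP with the circumcircle
    (hS : dist O S = dist O A) (hSl : Collinear ℝ ({A, P, S} : Set Pt)) (hSA : S ≠ A)
    -- T is the second intersection of line BP with the circumcircle
    (hT : dist O T = dist O B) (hTl : Collinear ℝ ({B, P, T} : Set Pt)) (hTB : T ≠ B)
    -- U is the second intersection of line CP with the circumcircle
    (hU : dist O U = dist O C) (hUl : Collinear ℝ ({C, P, U} : Set Pt)) (hUC : U ≠ C)
    -- X, Y, Z are the midpoints of AS, BT, CU
    (hX : X = midpoint ℝ A S) (hY : Y = midpoint ℝ B T) (hZ : Z = midpoint ℝ C U) :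
    dist (midpoint ℝ O P) X = dist O P / 2 ∧
      dist (midpoint ℝ O P) Y = dist O P / 2 ∧
        dist (midpoint ℝ O P) Z = dist O P / 2 := by
  subst hX hY hZ
  exact ⟨dist_midpoint_midpoint_of_collinear hS hSl hSA,
    dist_midpoint_midpoint_of_collinear hT hTl hTB,
    dist_midpoint_midpoint_of_collinear hU hUl hUC⟩
end

section
/- Let A_M be the second intersection point of ray AA_Y with the circumcircle of triangle ABC. Then the quadrilateral B A_Y C A_M is a parallelogram, i.e., A_Y B is parallel to A_M C, A_Y C is parallel to A_M B, and the midpoint of A_Y A_M coincides with the midpoint of BC. -/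
open EuclideanGeometry RealInnerProductSpace

/-- Equidistance of `P` from `X` and `Z`, expressed through inner products. -/
lemma inner_eq_of_dist_eq {V : Type*} [NormedAddCommGroup V] [InnerProductSpace ℝ V]
    {P X Z : V} (h : dist P X = dist P Z) :
    2 * ⟪P, X - Z⟫ = ⟪X, X⟫ - ⟪Z, Z⟫ := by
  have h2 : ⟪P - X, P - X⟫ = ⟪P - Z, P - Z⟫ := by
    rw [real_inner_self_eq_norm_sq, real_inner_self_eq_norm_sq, ← dist_eq_norm, ← dist_eq_norm, h]
  simp only [inner_sub_left, inner_sub_right, real_inner_comm X P, real_inner_comm Z P] at h2 ⊢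
  linarith

/-- In the plane, two vectors orthogonal to a common nonzero vector are proportional. -/
lemma exists_smul_eq_of_inner_eq_zero {d v w : Pt} (hd : d ≠ 0) (hv : v ≠ 0)
    (h₁ : ⟪d, v⟫ = 0) (h₂ : ⟪d, w⟫ = 0) : ∃ t : ℝ, w = t • v := by
  have : Fact (Module.finrank ℝ Pt = 1 + 1) := ⟨by simp⟩
  have hmem : ∀ x : Pt, ⟪d, x⟫ = 0 → x ∈ (Submodule.span ℝ {d})ᗮ := fun x hx ↦
    Submodule.mem_orthogonal_singleton_iff_inner_right.2 hx
  obtain ⟨t, ht⟩ := exists_smul_eq_of_finrank_eq_one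
    (Submodule.finrank_orthogonal_span_singleton (𝕜 := ℝ) (n := 1) hd)
    (x := ⟨v, hmem v h₁⟩) (by simpa using hv) ⟨w, hmem w h₂⟩
  exact ⟨t, by simpa using (congrArg Subtype.val ht).symm⟩

/-- If the chord from `a` to `a + r • a` of the circle centered at `P` through `a` is nontrivial,
the product `(1 + r) * ⟪a, a⟫` of the signed distances of its endpoints from the origin is the
power of the origin with respect to the circle. -/
lemma chord_mul_eq_power {V : Type*} [NormedAddCommGroup V] [InnerProductSpace ℝ V]
    {P a : V} {r : ℝ} (hr : r ≠ 0) (h : dist P (a + r • a) = dist P a) :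
    (1 + r) * ⟪a, a⟫ = 2 * ⟪P, a⟫ - ⟪a, a⟫ := by
  have := inner_eq_of_dist_eq h
  simp only [inner_sub_right, inner_add_left, inner_add_right, inner_smul_left,
    inner_smul_right, RCLike.conj_to_real] at this
  apply mul_left_cancel₀ hr
  linear_combination -this

/-- The parallelogram relation with the origin placed at the midpoint of `BC`. -/
lemma add_eq_zero_of_centered {a u p q o y m : Pt} (ha : a ≠ 0) (hu : u ≠ 0)
    (hoa : dist o a = dist o (-u)) (hou : dist o (-u) = dist o u)
    (hp : dist p a = dist p (-u)) (hpt : ⟪p + u, u⟫ = 0)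
    (hq : dist q a = dist q u) (hqt : ⟪q - u, u⟫ = 0)
    (hpy : dist p y = dist p a) (hqy : dist q y = dist q a) (hya : y ≠ a)
    (hm : dist o m = dist o a) (hmr : SameRay ℝ (y - a) (m - a)) (hma : m ≠ a) :
    y + m = 0 := by
  have huu : ⟪u, u⟫ ≠ 0 := inner_self_ne_zero.2 hu
  have haa : ⟪a, a⟫ ≠ 0 := inner_self_ne_zero.2 ha
  have ep := inner_eq_of_dist_eq hp
  have eq := inner_eq_of_dist_eq hq
  have eo := inner_eq_of_dist_eq hoa
  have eou := inner_eq_of_dist_eq hou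
  have epy := inner_eq_of_dist_eq hpy
  have eqy := inner_eq_of_dist_eq hqy
  simp only [inner_sub_left, inner_sub_right, inner_add_left, inner_neg_left, inner_neg_right]
    at ep eq eo eou epy eqy hpt hqt
  have hd : p - q ≠ 0 := by
    rintro hpq
    rw [sub_eq_zero.1 hpq] at hpt
    apply huu
    linarith
  obtain ⟨r, hr⟩ := exists_smul_eq_of_inner_eq_zero (w := y - a) hd ha
    (by simp only [inner_sub_left]; linarith)
    (by simp only [inner_sub_left, inner_sub_right]; linarith)
  obtain ⟨c, -, hc⟩ := hmr.exists_nonneg_left (sub_ne_zero.2 hya)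
  have hy : y = a + r • a := by rw [← hr]; abel
  have hm' : m = a + (c * r) • a := by rw [mul_smul, ← hr, hc]; abel
  have hr0 : r ≠ 0 := by rintro rfl; simp [hy] at hya
  have hcr0 : c * r ≠ 0 := by intro h; simp [hm', h] at hma
  have e₁ := chord_mul_eq_power hr0 (hy ▸ hpy)
  have e₂ := chord_mul_eq_power hcr0 (hm' ▸ hm)
  have e : (1 + r) + (1 + c * r) = 0 := by
    apply mul_right_cancel₀ haa
    linarith
  calc y + m = ((1 + r) + (1 + c * r)) • a := by rw [hy, hm']; module
    _ = 0 := by rw [e, zero_smul]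

/-- If `A_M` is the second intersection of ray `AA_Y` with the circumcircle of `ABC`,
then `B A_Y C A_M` is a parallelogram: `A_Y B ∥ A_M C`, `A_Y C ∥ A_M B`, and the
midpoint of `A_Y A_M` is the midpoint of `BC`. -/
theorem stmt_6 (A B C O A_Y A_M P₁ P₂ : Pt)
    (hABC : AffineIndependent ℝ ![A, B, C])
    -- O is the circumcenter of triangle ABC
    (hOA : dist O A = dist O B) (hOB : dist O B = dist O C)
    -- γ₁ : the circle with center P₁ through A and B, tangent to line BC at B
    (hP₁ : dist P₁ A = dist P₁ B) (hP₁t : ⟪P₁ - B, C - B⟫ = 0)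
    -- γ₂ : the circle with center P₂ through A and C, tangent to line BC at C
    (hP₂ : dist P₂ A = dist P₂ C) (hP₂t : ⟪P₂ - C, B - C⟫ = 0)
    -- A_Y is the second intersection point of γ₁ and γ₂
    (hY₁ : dist P₁ A_Y = dist P₁ A) (hY₂ : dist P₂ A_Y = dist P₂ A)
    (hYA : A_Y ≠ A)
    -- A_M is the second intersection of ray AA_Y with the circumcircle
    (hM : dist O A_M = dist O A) (hMr : SameRay ℝ (A_Y - A) (A_M - A))
    (hMA : A_M ≠ A) :
    (∃ t : ℝ, B - A_Y = t • (C - A_M)) ∧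
      (∃ t : ℝ, C - A_Y = t • (B - A_M)) ∧
        midpoint ℝ A_Y A_M = midpoint ℝ B C := by
  set M := midpoint ℝ B C with hMdef
  have hB : B - M = -((1 / 2 : ℝ) • (C - B)) := by
    rw [hMdef, midpoint_eq_smul_add, invOf_eq_inv]; module
  have hC : C - M = (1 / 2 : ℝ) • (C - B) := by
    rw [hMdef, midpoint_eq_smul_add, invOf_eq_inv]; module
  have hBC : B - M = -(C - M) := by rw [hB, hC]
  have hne : C ≠ B := hABC.injective.ne (show (2 : Fin 3) ≠ 1 by decide)
  have hAM : A ≠ M := by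
    intro h
    rw [affineIndependent_iff_not_collinear_set] at hABC
    apply hABC
    rw [Set.insert_comm, h]
    exact (wbtw_midpoint ℝ B C).collinear
  have hsum : (A_Y - M) + (A_M - M) = 0 := by
    apply add_eq_zero_of_centered (a := A - M) (u := C - M) (p := P₁ - M) (q := P₂ - M)
      (o := O - M)
    · exact sub_ne_zero.2 hAM
    · rw [hC]; simpa using sub_ne_zero.2 hne
    · rwa [← hBC, dist_sub_right, dist_sub_right]
    · rwa [← hBC, dist_sub_right, dist_sub_right]
    · rwa [← hBC, dist_sub_right, dist_sub_right]
    · rw [← sub_neg_eq_add, ← hBC, sub_sub_sub_cancel_right, hC, inner_smul_right, hP₁t, mul_zero]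
    · rwa [dist_sub_right, dist_sub_right]
    · rw [sub_sub_sub_cancel_right, hC, inner_smul_right, ← neg_sub B C, inner_neg_right, hP₂t]
      simp
    · rwa [dist_sub_right, dist_sub_right]
    · rwa [dist_sub_right, dist_sub_right]
    · simpa using hYA
    · rwa [dist_sub_right, dist_sub_right]
    · simpa only [sub_sub_sub_cancel_right] using hMr
    · simpa using hMA
  have key : A_Y + A_M = B + C := by
    have hBC' : B - M + (C - M) = 0 := by rw [hBC]; abel
    calc A_Y + A_M = (A_Y - M + (A_M - M)) + (M + M) := by abel
      _ = (B - M + (C - M)) + (M + M) := by rw [hsum, hBC']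
      _ = B + C := by abel
  have hAY : A_Y = B + C - A_M := eq_sub_of_add_eq key
  refine ⟨⟨-1, by rw [hAY]; module⟩, ⟨-1, by rw [hAY]; module⟩, ?_⟩
  rw [hMdef, midpoint_eq_smul_add, midpoint_eq_smul_add, key]
end

section
/- The point A_Y is the reflection of A_S across the line BC, where A_S is the second intersection point of the line AA_X with the circumcircle of triangle ABC. -/
open EuclideanGeometry RealInnerProductSpace

/-- Two points are equidistant from `O` iff an inner product relation based at `A` holds. -/
lemma two_mul_inner_of_dist_eq {O P A : Pt} (h : dist O P = dist O A) :
    2 * ⟪O - A, P - A⟫ = ⟪P - A, P - A⟫ := by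
  have h1 : ‖(O - A) - (P - A)‖ = ‖O - A‖ := by
    rw [sub_sub_sub_cancel_right, ← dist_eq_norm, ← dist_eq_norm, h]
  have h2 := norm_sub_sq_real (O - A) (P - A)
  rw [h1] at h2
  rw [real_inner_self_eq_norm_sq]
  linarith

/-- Two linearly independent vectors span the plane. -/
lemma exists_eq_smul_add_smul {b c : Pt} (h : LinearIndependent ℝ ![b, c]) (v : Pt) :
    ∃ x y : ℝ, v = x • b + y • c := by
  have hv : v ∈ Submodule.span ℝ (Set.range ![b, c]) := by
    rw [h.span_eq_top_of_card_eq_finrank (by simp)]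
    trivial
  rw [Matrix.range_cons, Matrix.range_cons, Matrix.range_empty, Set.union_empty,
    Set.singleton_union, Submodule.mem_span_pair] at hv
  obtain ⟨x, y, hxy⟩ := hv
  exact ⟨x, y, hxy.symm⟩

/-- The second intersection of the circles through the origin tangent to the sides at the origin
lies on the symmedian. -/
lemma exists_eq_smul_symmedian {b c o₁ o₂ v : Pt} (h : LinearIndependent ℝ ![b, c])
    (h₁b : 2 * ⟪o₁, b⟫ = ⟪b, b⟫) (h₁c : ⟪o₁, c⟫ = 0)
    (h₂c : 2 * ⟪o₂, c⟫ = ⟪c, c⟫) (h₂b : ⟪o₂, b⟫ = 0)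
    (h₁v : 2 * ⟪o₁, v⟫ = ⟪v, v⟫) (h₂v : 2 * ⟪o₂, v⟫ = ⟪v, v⟫) :
    ∃ k : ℝ, v = k • (⟪c, c⟫ • b + ⟪b, b⟫ • c) := by
  have hb : ⟪b, b⟫ ≠ 0 := inner_self_ne_zero.mpr (h.ne_zero 0)
  have hc : ⟪c, c⟫ ≠ 0 := inner_self_ne_zero.mpr (h.ne_zero 1)
  obtain ⟨x, y, hv⟩ := exists_eq_smul_add_smul h v
  have e₁ : ⟪o₁, v⟫ = x * ⟪o₁, b⟫ + y * ⟪o₁, c⟫ := by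
    rw [hv, inner_add_right, real_inner_smul_right, real_inner_smul_right]
  have e₂ : ⟪o₂, v⟫ = x * ⟪o₂, b⟫ + y * ⟪o₂, c⟫ := by
    rw [hv, inner_add_right, real_inner_smul_right, real_inner_smul_right]
  have hxy : x * ⟪b, b⟫ = y * ⟪c, c⟫ := by
    linear_combination h₁v - h₂v - 2 * e₁ + 2 * e₂ - x * h₁b + y * h₂c - 2 * y * h₁c + 2 * x * h₂b
  refine ⟨x / ⟪c, c⟫, ?_⟩
  rw [hv, smul_add, smul_smul, smul_smul, div_mul_cancel₀ _ hc, div_mul_eq_mul_div, hxy,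
    mul_div_cancel_right₀ _ hc]

/-- The second intersection of the circles through the origin tangent to the opposite side at its
endpoints lies on the median, at an explicit position. -/
lemma exists_eq_smul_median {b c p₁ p₂ v : Pt} (h : LinearIndependent ℝ ![b, c])
    (h₁b : 2 * ⟪p₁, b⟫ = ⟪b, b⟫) (h₁t : ⟪p₁ - b, c - b⟫ = 0)
    (h₂c : 2 * ⟪p₂, c⟫ = ⟪c, c⟫) (h₂t : ⟪p₂ - c, b - c⟫ = 0)
    (h₁v : 2 * ⟪p₁, v⟫ = ⟪v, v⟫) (h₂v : 2 * ⟪p₂, v⟫ = ⟪v, v⟫) (hv0 : v ≠ 0) :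
    ∃ t : ℝ, v = t • (b + c) ∧ t * ⟪b + c, b + c⟫ = 2 * ⟪b, c⟫ := by
  have hbc : b - c ≠ 0 := fun h0 => by
    have := h.injective.ne (show (0 : Fin 2) ≠ 1 by decide)
    exact this (by simpa using sub_eq_zero.mp h0)
  have hn : ⟪b - c, b - c⟫ ≠ 0 := inner_self_ne_zero.mpr hbc
  obtain ⟨x, y, hv⟩ := exists_eq_smul_add_smul h v
  have e₁ : ⟪p₁, v⟫ = x * ⟪p₁, b⟫ + y * ⟪p₁, c⟫ := by
    rw [hv, inner_add_right, real_inner_smul_right, real_inner_smul_right]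
  have e₂ : ⟪p₂, v⟫ = x * ⟪p₂, b⟫ + y * ⟪p₂, c⟫ := by
    rw [hv, inner_add_right, real_inner_smul_right, real_inner_smul_right]
  have hcb := real_inner_comm b c
  simp only [inner_sub_left, inner_sub_right] at h₁t h₂t hn
  have hxy : (x - y) * (⟪b, b⟫ - ⟪c, b⟫ - (⟪b, c⟫ - ⟪c, c⟫)) = 0 := by
    linear_combination h₁v - h₂v - 2 * e₁ + 2 * e₂ - x * h₁b + y * h₂c - 2 * y * h₁t
      + 2 * x * h₂t - y * h₁b + x * h₂c
      + (x + y) * hcb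
  obtain rfl : x = y := sub_eq_zero.mp ((mul_eq_zero.mp hxy).resolve_right hn)
  rw [← smul_add] at hv
  have hx : x ≠ 0 := by
    rintro rfl
    exact hv0 (by simpa using hv)
  refine ⟨x, hv, mul_left_cancel₀ hx ?_⟩
  have e₃ : ⟪v, v⟫ = x * (x * ⟪b + c, b + c⟫) := by
    rw [hv, real_inner_smul_left, real_inner_smul_right]
  linear_combination -e₃ - h₁v + 2 * e₁ + 2 * x * h₁t + 2 * x * h₁b

/-- The second intersection of the symmedian with the circumcircle, at an explicit position. -/
lemma symmedian_inter_circumcircle {b c o v : Pt} {k : ℝ} (h : LinearIndependent ℝ ![b, c])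
    (hb : 2 * ⟪o, b⟫ = ⟪b, b⟫) (hc : 2 * ⟪o, c⟫ = ⟪c, c⟫) (hv : 2 * ⟪o, v⟫ = ⟪v, v⟫)
    (hk : v = k • (⟪c, c⟫ • b + ⟪b, b⟫ • c)) (hv0 : v ≠ 0) :
    k * ⟪b + c, b + c⟫ = 2 := by
  have hb0 : ⟪b, b⟫ ≠ 0 := inner_self_ne_zero.mpr (h.ne_zero 0)
  have hc0 : ⟪c, c⟫ ≠ 0 := inner_self_ne_zero.mpr (h.ne_zero 1)
  have hk0 : k ≠ 0 := by
    rintro rfl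
    exact hv0 (by simpa using hk)
  rw [hk] at hv
  have hcb := real_inner_comm b c
  simp only [inner_add_left, inner_add_right, real_inner_smul_left, real_inner_smul_right] at hv ⊢
  refine mul_left_cancel₀ (mul_ne_zero hk0 (mul_ne_zero hb0 hc0)) ?_
  rw [hcb] at *
  linear_combination -hv + k * ⟪c, c⟫ * hb + k * ⟪b, b⟫ * hc

/-- `A_Y` is the reflection of `A_S` across line `BC`, where `A_S` is the second
intersection of line `AA_X` with the circumcircle of `ABC`: the segment `A_S A_Y` is
perpendicular to `BC` and its midpoint lies on line `BC`. -/
theorem stmt_7 (A B C O A_X A_Y A_S O₁ O₂ P₁ P₂ : Pt)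
    (hABC : AffineIndependent ℝ ![A, B, C])
    -- O is the circumcenter of triangle ABC
    (hOA : dist O A = dist O B) (hOB : dist O B = dist O C)
    -- ω₁ : the circle with center O₁ through A and B, tangent to line AC at A
    (hO₁ : dist O₁ A = dist O₁ B) (hO₁t : ⟪O₁ - A, C - A⟫ = 0)
    -- ω₂ : the circle with center O₂ through A and C, tangent to line AB at A
    (hO₂ : dist O₂ A = dist O₂ C) (hO₂t : ⟪O₂ - A, B - A⟫ = 0)
    -- A_X is the second intersection point of ω₁ and ω₂
    (hX₁ : dist O₁ A_X = dist O₁ A) (hX₂ : dist O₂ A_X = dist O₂ A)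
    (hXA : A_X ≠ A)
    -- γ₁ : the circle with center P₁ through A and B, tangent to line BC at B
    (hP₁ : dist P₁ A = dist P₁ B) (hP₁t : ⟪P₁ - B, C - B⟫ = 0)
    -- γ₂ : the circle with center P₂ through A and C, tangent to line BC at C
    (hP₂ : dist P₂ A = dist P₂ C) (hP₂t : ⟪P₂ - C, B - C⟫ = 0)
    -- A_Y is the second intersection point of γ₁ and γ₂
    (hY₁ : dist P₁ A_Y = dist P₁ A) (hY₂ : dist P₂ A_Y = dist P₂ A)
    (hYA : A_Y ≠ A)
    -- A_S is the second intersection of line AA_X with the circumcircle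
    (hS : dist O A_S = dist O A) (hSl : Collinear ℝ ({A, A_X, A_S} : Set Pt))
    (hSA : A_S ≠ A) :
    ⟪A_Y - A_S, C - B⟫ = 0 ∧ midpoint ℝ A_S A_Y ∈ affineSpan ℝ ({B, C} : Set Pt) := by
  have hli : LinearIndependent ℝ ![B - A, C - A] := by
    rw [affineIndependent_iff_linearIndependent_vsub ℝ _ (0 : Fin 3),
      ← linearIndependent_equiv (finSuccAboveEquiv (0 : Fin 3))] at hABC
    convert hABC using 1
    · ext i j
      fin_cases i <;> simp [finSuccAboveEquiv]
    · rfl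
  have tb (P : Pt) : P - B = (P - A) - (B - A) := (sub_sub_sub_cancel_right _ _ _).symm
  have tc (P : Pt) : P - C = (P - A) - (C - A) := (sub_sub_sub_cancel_right _ _ _).symm
  obtain ⟨k, hk⟩ := exists_eq_smul_symmedian hli (two_mul_inner_of_dist_eq hO₁.symm) hO₁t
    (two_mul_inner_of_dist_eq hO₂.symm) hO₂t (two_mul_inner_of_dist_eq hX₁)
    (two_mul_inner_of_dist_eq hX₂)
  rw [tb P₁, tb C] at hP₁t
  rw [tc P₂, tc B] at hP₂t
  obtain ⟨t, ht, htn⟩ := exists_eq_smul_median hli (two_mul_inner_of_dist_eq hP₁.symm) hP₁t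
    (two_mul_inner_of_dist_eq hP₂.symm) hP₂t (two_mul_inner_of_dist_eq hY₁)
    (two_mul_inner_of_dist_eq hY₂) (sub_ne_zero.mpr hYA)
  obtain ⟨r, hr⟩ : ∃ r : ℝ, A_S - A = r • (A_X - A) := by
    obtain ⟨w, hw⟩ := (collinear_iff_of_mem (p₀ := A) (by simp)).mp hSl
    obtain ⟨x, hx⟩ := hw A_X (by simp)
    obtain ⟨s, hs⟩ := hw A_S (by simp)
    have hx0 : x ≠ 0 := by
      rintro rfl
      exact hXA (by simpa using hx)
    refine ⟨s / x, ?_⟩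
    rw [hx, hs, vadd_eq_add, vadd_eq_add, add_sub_cancel_right, add_sub_cancel_right, smul_smul,
      div_mul_cancel₀ _ hx0]
  rw [hk, smul_smul] at hr
  have hsn := symmedian_inter_circumcircle hli (two_mul_inner_of_dist_eq hOA.symm)
    (two_mul_inner_of_dist_eq (hOA.trans hOB).symm) (two_mul_inner_of_dist_eq hS) hr
    (sub_ne_zero.mpr hSA)
  set b := B - A with hb
  set c := C - A with hc
  set s := r * k
  have hcb := real_inner_comm b c
  have hn : ⟪b + c, b + c⟫ = ⟪b, b⟫ + 2 * ⟪b, c⟫ + ⟪c, c⟫ := real_inner_add_add_self b c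
  have hts : t = s * ⟪b, c⟫ := by
    have hn0 : ⟪b + c, b + c⟫ ≠ 0 := fun h0 => by
      rw [h0, mul_zero] at hsn
      exact two_ne_zero hsn.symm
    refine mul_right_cancel₀ hn0 ?_
    linear_combination htn - ⟪b, c⟫ * hsn
  constructor
  · have e : A_Y - A_S = t • (b + c) - s • (⟪c, c⟫ • b + ⟪b, b⟫ • c) := by
      rw [← ht, ← hr, sub_sub_sub_cancel_right]
    rw [e, tb C]
    simp only [inner_add_left, inner_sub_left, inner_sub_right, real_inner_smul_left, ← hc]
    rw [hcb, hts]
    ring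
  · have e : midpoint ℝ A_S A_Y = AffineMap.lineMap B C ((t + s * ⟪b, b⟫) / 2) := by
      have hS' : A_S = s • (⟪c, c⟫ • b + ⟪b, b⟫ • c) + A := by rw [← hr, sub_add_cancel]
      have hY' : A_Y = t • (b + c) + A := by rw [← ht, sub_add_cancel]
      have hB : B = b + A := by rw [hb, sub_add_cancel]
      have hC : C = c + A := by rw [hc, sub_add_cancel]
      have hsum : s * ⟪c, c⟫ = 2 - 2 * t - s * ⟪b, b⟫ := by
        rw [hn] at hsn
        linear_combination hsn + 2 * hts
      rw [smul_add, smul_smul, smul_smul, hsum] at hS'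
      rw [AffineMap.lineMap_apply, midpoint_eq_smul_add, vsub_eq_sub, vadd_eq_add]
      clear_value b c s
      subst hB hC
      rw [hS', hY', invOf_eq_inv]
      module
    rw [e]
    exact AffineMap.lineMap_mem_affineSpan_pair _ _ _
end

section
/- Let M_BC, M_CA, M_AB be the midpoints of BC, CA, AB respectively, and let A_G be the midpoint of segment AA_Y. Then A_G lies on the circumcircle of the medial triangle M_AB M_BC M_CA (the nine-point circle of triangle ABC). -/
open EuclideanGeometry RealInnerProductSpace

/-- Let two circles centred at `p` and `q` be tangent to the line through `-b` and `b` at `-b` and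
`b` respectively, and meet in the points `a ≠ y`. As the origin has power `‖b‖²` with respect to
both of them, `y` is the inverse of `a` in the circle of radius `‖b‖` about the origin. -/
lemma second_intersection_eq_inverse {a₀ a₁ b₀ b₁ p₀ p₁ q₀ q₁ y₀ y₁ : ℝ}
    (hD : a₀ * b₁ - a₁ * b₀ ≠ 0)
    (hp : (p₀ - a₀) ^ 2 + (p₁ - a₁) ^ 2 = (p₀ + b₀) ^ 2 + (p₁ + b₁) ^ 2)
    (hpt : (p₀ + b₀) * b₀ + (p₁ + b₁) * b₁ = 0)
    (hq : (q₀ - a₀) ^ 2 + (q₁ - a₁) ^ 2 = (q₀ - b₀) ^ 2 + (q₁ - b₁) ^ 2)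
    (hqt : (q₀ - b₀) * b₀ + (q₁ - b₁) * b₁ = 0)
    (hpy : (p₀ - y₀) ^ 2 + (p₁ - y₁) ^ 2 = (p₀ - a₀) ^ 2 + (p₁ - a₁) ^ 2)
    (hqy : (q₀ - y₀) ^ 2 + (q₁ - y₁) ^ 2 = (q₀ - a₀) ^ 2 + (q₁ - a₁) ^ 2)
    (hya : ¬(y₀ = a₀ ∧ y₁ = a₁)) :
    ∃ t : ℝ, y₀ = t * a₀ ∧ y₁ = t * a₁ ∧ t * (a₀ ^ 2 + a₁ ^ 2) = b₀ ^ 2 + b₁ ^ 2 := by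
  have ha : a₀ ^ 2 + a₁ ^ 2 ≠ 0 := fun h => hD <| by
    have h0 : a₀ = 0 := by nlinarith [sq_nonneg a₀, sq_nonneg a₁]
    have h1 : a₁ = 0 := by nlinarith [sq_nonneg a₀, sq_nonneg a₁]
    simp [h0, h1]
  have hb : b₀ ^ 2 + b₁ ^ 2 ≠ 0 := fun h => hD <| by
    have h0 : b₀ = 0 := by nlinarith [sq_nonneg b₀, sq_nonneg b₁]
    have h1 : b₁ = 0 := by nlinarith [sq_nonneg b₀, sq_nonneg b₁]
    simp [h0, h1]
  have power_a : a₀ ^ 2 + a₁ ^ 2 - 2 * (p₀ * a₀ + p₁ * a₁) + (b₀ ^ 2 + b₁ ^ 2) = 0 := by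
    linear_combination hp + 2 * hpt
  have power_y : y₀ ^ 2 + y₁ ^ 2 - 2 * (p₀ * y₀ + p₁ * y₁) + (b₀ ^ 2 + b₁ ^ 2) = 0 := by
    linear_combination hp + 2 * hpt + hpy
  have perp_a : (p₀ - q₀) * a₀ + (p₁ - q₁) * a₁ = 0 := by
    linear_combination (hq - 2 * hqt - hp - 2 * hpt) / 2
  have perp_y : (p₀ - q₀) * y₀ + (p₁ - q₁) * y₁ = 0 := by
    linear_combination (hq - 2 * hqt + hqy - hp - 2 * hpt - hpy) / 2
  have centers_ne : (p₀ - q₀) * b₀ + (p₁ - q₁) * b₁ = -2 * (b₀ ^ 2 + b₁ ^ 2) := by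
    linear_combination hpt - hqt
  have collinear : a₀ * y₁ - a₁ * y₀ = 0 := by
    refine (mul_eq_zero.mp ?_).resolve_left hb
    linear_combination (a₀ * y₁ - a₁ * y₀) / 2 * centers_ne
      - (b₀ * y₁ - b₁ * y₀) / 2 * perp_a - (a₀ * b₁ - a₁ * b₀) / 2 * perp_y
  obtain ⟨t, h0, h1⟩ : ∃ t : ℝ, y₀ = t * a₀ ∧ y₁ = t * a₁ := by
    refine ⟨(y₀ * a₀ + y₁ * a₁) / (a₀ ^ 2 + a₁ ^ 2), ?_, ?_⟩ <;> field_simp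
    · linear_combination (-a₁) * collinear
    · linear_combination a₀ * collinear
  subst h0 h1
  refine ⟨t, rfl, rfl, ?_⟩
  have ht : t - 1 ≠ 0 := fun h => hya <| by
    obtain rfl : t = 1 := by linarith
    simp
  refine sub_eq_zero.mp ((mul_eq_zero.mp ?_).resolve_left ht)
  linear_combination power_y - t * power_a

/-- If `y = t • a` is the inverse of `a` in the circle of radius `‖b‖` about the origin, then some
point `n` is equidistant from the origin, from the midpoints of `a, b` and `a, -b`, and from the
midpoint of `a, y`. -/
lemma exists_nine_point_center {a₀ a₁ b₀ b₁ t : ℝ} (hD : a₀ * b₁ - a₁ * b₀ ≠ 0)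
    (ht : t * (a₀ ^ 2 + a₁ ^ 2) = b₀ ^ 2 + b₁ ^ 2) :
    ∃ n₀ n₁ : ℝ,
      ((a₀ - b₀) / 2 - n₀) ^ 2 + ((a₁ - b₁) / 2 - n₁) ^ 2 = n₀ ^ 2 + n₁ ^ 2 ∧
      ((a₀ + b₀) / 2 - n₀) ^ 2 + ((a₁ + b₁) / 2 - n₁) ^ 2 = n₀ ^ 2 + n₁ ^ 2 ∧
      ((a₀ + t * a₀) / 2 - n₀) ^ 2 + ((a₁ + t * a₁) / 2 - n₁) ^ 2 = n₀ ^ 2 + n₁ ^ 2 := by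
  obtain ⟨n₀, n₁, hna, hnb⟩ : ∃ n₀ n₁ : ℝ,
      n₀ * a₀ + n₁ * a₁ = (a₀ ^ 2 + a₁ ^ 2 + b₀ ^ 2 + b₁ ^ 2) / 4 ∧
      n₀ * b₀ + n₁ * b₁ = (a₀ * b₀ + a₁ * b₁) / 2 := by
    generalize (a₀ ^ 2 + a₁ ^ 2 + b₀ ^ 2 + b₁ ^ 2) / 4 = α
    generalize (a₀ * b₀ + a₁ * b₁) / 2 = β
    refine ⟨(α * b₁ - β * a₁) / (a₀ * b₁ - a₁ * b₀),
      (β * a₀ - α * b₀) / (a₀ * b₁ - a₁ * b₀), ?_, ?_⟩ <;>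
    · rw [div_mul_eq_mul_div, div_mul_eq_mul_div, ← add_div, div_eq_iff hD]
      ring
  refine ⟨n₀, n₁, ?_, ?_, ?_⟩
  · linear_combination hnb - hna
  · linear_combination -hnb - hna
  · linear_combination (1 + t) / 4 * ht - (1 + t) * hna

/-- Twice the signed area of a nondegenerate triangle does not vanish. -/
lemma signed_area_ne_zero_of_affineIndependent {A B C : Pt}
    (h : AffineIndependent ℝ ![A, B, C]) :
    (B 0 - A 0) * (C 1 - A 1) - (B 1 - A 1) * (C 0 - A 0) ≠ 0 := by
  intro hD
  rw [affineIndependent_iff_not_collinear_set] at h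
  by_cases hAB : A = B
  · subst hAB
    exact h (by simpa using collinear_pair ℝ A C)
  have hN : (B 0 - A 0) ^ 2 + (B 1 - A 1) ^ 2 ≠ 0 := fun hN => hAB <| by
    ext i
    fin_cases i
    · show A 0 = B 0
      nlinarith [sq_nonneg (B 0 - A 0), sq_nonneg (B 1 - A 1)]
    · show A 1 = B 1
      nlinarith [sq_nonneg (B 0 - A 0), sq_nonneg (B 1 - A 1)]
  refine h ((collinear_iff_of_mem (p₀ := A) (by simp)).mpr ⟨B - A, ?_⟩)
  simp only [Set.mem_insert_iff, Set.mem_singleton_iff, forall_eq_or_imp, forall_eq]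
  refine ⟨⟨0, by simp⟩, ⟨1, by simp⟩,
    ⟨((C 0 - A 0) * (B 0 - A 0) + (C 1 - A 1) * (B 1 - A 1)) /
      ((B 0 - A 0) ^ 2 + (B 1 - A 1) ^ 2), ?_⟩⟩
  ext i
  fin_cases i <;>
    simp only [Fin.zero_eta, Fin.mk_one, vadd_eq_add, PiLp.add_apply, PiLp.smul_apply,
      PiLp.sub_apply, smul_eq_mul] <;> field_simp
  · linear_combination (-(B 1 - A 1)) * hD
  · linear_combination (B 0 - A 0) * hD

lemma dist_eq_dist_iff_coords {P Q R S : Pt} :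
    dist P Q = dist R S ↔
      (P 0 - Q 0) ^ 2 + (P 1 - Q 1) ^ 2 = (R 0 - S 0) ^ 2 + (R 1 - S 1) ^ 2 := by
  rw [← sq_eq_sq₀ dist_nonneg dist_nonneg]
  simp [EuclideanSpace.dist_sq_eq, Real.dist_eq, sq_abs, Fin.sum_univ_two]

lemma midpoint_coord (P Q : Pt) (i : Fin 2) : midpoint ℝ P Q i = (P i + Q i) / 2 := by
  rw [midpoint_eq_smul_add]
  simp
  ring

/-- The midpoint `A_G` of segment `AA_Y` lies on the circumcircle of the medial triangle
`M_AB M_BC M_CA` (the nine-point circle of triangle `ABC`). -/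
theorem stmt_9 (A B C A_Y A_G M_BC M_CA M_AB P₁ P₂ : Pt)
    (hABC : AffineIndependent ℝ ![A, B, C])
    -- γ₁ : the circle with center P₁ through A and B, tangent to line BC at B
    (hP₁ : dist P₁ A = dist P₁ B) (hP₁t : ⟪P₁ - B, C - B⟫ = 0)
    -- γ₂ : the circle with center P₂ through A and C, tangent to line BC at C
    (hP₂ : dist P₂ A = dist P₂ C) (hP₂t : ⟪P₂ - C, B - C⟫ = 0)
    -- A_Y is the second intersection point of γ₁ and γ₂
    (hY₁ : dist P₁ A_Y = dist P₁ A) (hY₂ : dist P₂ A_Y = dist P₂ A)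
    (hYA : A_Y ≠ A)
    -- the midpoints of the sides
    (hMBC : M_BC = midpoint ℝ B C) (hMCA : M_CA = midpoint ℝ C A)
    (hMAB : M_AB = midpoint ℝ A B)
    -- A_G is the midpoint of AA_Y
    (hAG : A_G = midpoint ℝ A A_Y) :
    EuclideanGeometry.Cospherical ({M_AB, M_BC, M_CA, A_G} : Set Pt) := by
  subst hMBC hMCA hMAB hAG
  have hD := signed_area_ne_zero_of_affineIndependent hABC
  rw [dist_eq_dist_iff_coords] at hP₁ hP₂ hY₁ hY₂
  simp only [PiLp.inner_apply, Fin.sum_univ_two, PiLp.sub_apply, RCLike.inner_apply,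
    conj_trivial] at hP₁t hP₂t
  have hD' : (A 0 - (B 0 + C 0) / 2) * ((C 1 - B 1) / 2) -
      (A 1 - (B 1 + C 1) / 2) * ((C 0 - B 0) / 2) ≠ 0 := by
    contrapose! hD
    linear_combination -2 * hD
  obtain ⟨t, h0, h1, ht⟩ := second_intersection_eq_inverse
    (p₀ := P₁ 0 - (B 0 + C 0) / 2) (p₁ := P₁ 1 - (B 1 + C 1) / 2)
    (q₀ := P₂ 0 - (B 0 + C 0) / 2) (q₁ := P₂ 1 - (B 1 + C 1) / 2)
    (y₀ := A_Y 0 - (B 0 + C 0) / 2) (y₁ := A_Y 1 - (B 1 + C 1) / 2) hD'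
    (by linear_combination hP₁) (by linear_combination hP₁t / 2)
    (by linear_combination hP₂) (by linear_combination -hP₂t / 2)
    (by linear_combination hY₁) (by linear_combination hY₂)
    (fun h => hYA <| by
      ext i
      fin_cases i
      · exact sub_left_inj.mp h.1
      · exact sub_left_inj.mp h.2)
  obtain ⟨n₀, n₁, hAB, hCA, hAY⟩ := exists_nine_point_center hD' ht
  rw [← h0, ← h1] at hAY
  let N : Pt := !₂[(B 0 + C 0) / 2 + n₀, (B 1 + C 1) / 2 + n₁]
  have hN0 : N 0 = (B 0 + C 0) / 2 + n₀ := rfl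
  have hN1 : N 1 = (B 1 + C 1) / 2 + n₁ := rfl
  refine ⟨N, dist (midpoint ℝ B C) N, ?_⟩
  simp only [Set.mem_insert_iff, Set.mem_singleton_iff, forall_eq_or_imp, forall_eq,
    dist_eq_dist_iff_coords, midpoint_coord, hN0, hN1]
  refine ⟨?_, trivial, ?_, ?_⟩
  · linear_combination hAB
  · linear_combination hCA
  · linear_combination hAY
end

section
/- Let M_CA, M_AB be the midpoints of CA and AB, let A_G be the midpoint of segment AA_Y, and let A_GY be the point such that M_AB A_G M_CA A_GY is a parallelogram (i.e., A_GY = M_AB + M_CA − A_G). Then A_GY is the midpoint of segment AA_M, where A_M is the second intersection point of ray AA_Y with the circumcircle of triangle ABC. -/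
open EuclideanGeometry RealInnerProductSpace

section InnerProductSpace

variable {E : Type*} [NormedAddCommGroup E] [InnerProductSpace ℝ E]

/-- A point is equidistant from `A` and `B` iff it satisfies the equation of their bisector. -/
lemma dist_eq_dist_iff_two_inner {P A B : E} :
    dist P B = dist P A ↔ 2 * ⟪P - A, B - A⟫ = ⟪B - A, B - A⟫ := by
  have h : ‖P - B‖ ^ 2 = ‖P - A‖ ^ 2 - 2 * ⟪P - A, B - A⟫ + ‖B - A‖ ^ 2 := by
    rw [← norm_sub_sq_real, sub_sub_sub_cancel_right]
  rw [dist_eq_norm, dist_eq_norm, real_inner_self_eq_norm_sq,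
    ← sq_eq_sq₀ (norm_nonneg _) (norm_nonneg _), h]
  constructor <;> intro h' <;> linarith

/-- If `p` is the center of a circle through `0` and `b` tangent at `b` to the line through
`b` and `c`, then `b + c` has inner product `⟪b, c⟫` with `p`. -/
lemma inner_add_of_tangent {p b c : E} (hp : 2 * ⟪p, b⟫ = ⟪b, b⟫)
    (ht : ⟪p - b, c - b⟫ = 0) : ⟪p, b + c⟫ = ⟪b, c⟫ := by
  simp only [inner_sub_left, inner_sub_right] at ht
  rw [inner_add_right]
  linarith

/-- The second intersection of the line spanned by `w` with the circle through `0`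
centered at `p`. -/
lemma smul_mul_inner_self_of_two_inner {p w : E} {t : ℝ} (ht : t ≠ 0)
    (h : 2 * ⟪p, t • w⟫ = ⟪t • w, t • w⟫) : t * ⟪w, w⟫ = 2 * ⟪p, w⟫ := by
  simp only [real_inner_smul_left, real_inner_smul_right] at h
  apply mul_left_cancel₀ ht
  linarith

end InnerProductSpace

/-- In the plane, two vectors orthogonal to the same nonzero vector are parallel. -/
lemma exists_eq_smul_of_inner_eq_zero {n w y : Pt} (hn : n ≠ 0) (hw : w ≠ 0)
    (hnw : ⟪n, w⟫ = 0) (hny : ⟪n, y⟫ = 0) : ∃ t : ℝ, y = t • w := by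
  have hfin : Module.finrank ℝ (ℝ ∙ n)ᗮ = 1 := by
    have : Fact (Module.finrank ℝ Pt = 1 + 1) := ⟨by simp⟩
    exact Submodule.finrank_orthogonal_span_singleton hn
  have hw' : w ∈ (ℝ ∙ n)ᗮ := Submodule.mem_orthogonal_singleton_iff_inner_right.2 hnw
  have hy' : y ∈ (ℝ ∙ n)ᗮ := Submodule.mem_orthogonal_singleton_iff_inner_right.2 hny
  obtain ⟨t, ht⟩ := (finrank_eq_one_iff_of_nonzero' (⟨w, hw'⟩ : (ℝ ∙ n)ᗮ)
    (by simpa [Subtype.ext_iff] using hw)).1 hfin ⟨y, hy'⟩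
  exact ⟨t, (congrArg Subtype.val ht).symm⟩

/-- With `A_G` the midpoint of `AA_Y` and `A_GY = M_AB + M_CA − A_G` (so that
`M_AB A_G M_CA A_GY` is a parallelogram), the point `A_GY` is the midpoint of `AA_M`,
where `A_M` is the second intersection of ray `AA_Y` with the circumcircle of `ABC`. -/
theorem stmt_10 (A B C O A_Y A_M A_G A_GY M_CA M_AB P₁ P₂ : Pt)
    (hABC : AffineIndependent ℝ ![A, B, C])
    -- O is the circumcenter of triangle ABC
    (hOA : dist O A = dist O B) (hOB : dist O B = dist O C)
    -- γ₁ : the circle with center P₁ through A and B, tangent to line BC at B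
    (hP₁ : dist P₁ A = dist P₁ B) (hP₁t : ⟪P₁ - B, C - B⟫ = 0)
    -- γ₂ : the circle with center P₂ through A and C, tangent to line BC at C
    (hP₂ : dist P₂ A = dist P₂ C) (hP₂t : ⟪P₂ - C, B - C⟫ = 0)
    -- A_Y is the second intersection point of γ₁ and γ₂
    (hY₁ : dist P₁ A_Y = dist P₁ A) (hY₂ : dist P₂ A_Y = dist P₂ A)
    (hYA : A_Y ≠ A)
    -- midpoints of CA and AB
    (hMCA : M_CA = midpoint ℝ C A) (hMAB : M_AB = midpoint ℝ A B)
    -- A_G is the midpoint of AA_Y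
    (hAG : A_G = midpoint ℝ A A_Y)
    -- A_GY completes the parallelogram M_AB A_G M_CA A_GY
    (hAGY : A_GY = M_AB + M_CA - A_G)
    -- A_M is the second intersection of ray AA_Y with the circumcircle
    (hM : dist O A_M = dist O A) (hMr : SameRay ℝ (A_Y - A) (A_M - A))
    (hMA : A_M ≠ A) :
    A_GY = midpoint ℝ A A_M := by
  have hbc : LinearIndependent ℝ ![B - A, C - A] := by
    rw [affineIndependent_iff_linearIndependent_vsub ℝ _ (0 : Fin 3),
      ← linearIndependent_equiv (finSuccAboveEquiv (0 : Fin 3))] at hABC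
    have h : ![B - A, C - A] =
        (fun i : { x // x ≠ (0 : Fin 3) } ↦ ![A, B, C] i -ᵥ ![A, B, C] 0) ∘
          finSuccAboveEquiv (0 : Fin 3) := by
      ext i : 1
      fin_cases i <;> rfl
    rwa [h]
  rw [LinearIndependent.pair_iff] at hbc
  have hw : (B - A) + (C - A) ≠ 0 := fun h ↦ by simpa using hbc 1 1 (by simpa using h)
  have hBC : C - B ≠ 0 := fun h ↦ by
    simpa using hbc (-1) 1 (by rw [← h]; module)
  have hOB' := dist_eq_dist_iff_two_inner.1 hOA.symm
  have hOC' := dist_eq_dist_iff_two_inner.1 (hOA.trans hOB).symm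
  rw [eq_comm, dist_eq_dist_iff_two_inner] at hP₁ hP₂
  rw [dist_eq_dist_iff_two_inner] at hY₁ hY₂ hM
  have h₁ := inner_add_of_tangent (c := C - A) hP₁ (by simpa using hP₁t)
  have h₂ := inner_add_of_tangent (c := B - A) hP₂ (by simpa using hP₂t)
  rw [add_comm (C - A), real_inner_comm (B - A)] at h₂
  have hP : P₁ - P₂ ≠ 0 := fun h ↦ by
    rw [sub_eq_zero.1 h] at hP₁t
    have hself : ⟪C - B, C - B⟫ = 0 := by
      have : C - B = (P₂ - B) - (P₂ - C) := by abel
      rw [← neg_sub C B, inner_neg_right, neg_eq_zero] at hP₂t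
      nth_rw 1 [this]
      rw [inner_sub_left, hP₁t, hP₂t, sub_zero]
    exact hBC (inner_self_eq_zero.1 hself)
  have hP' : P₁ - P₂ = (P₁ - A) - (P₂ - A) := by abel
  obtain ⟨t, ht⟩ := exists_eq_smul_of_inner_eq_zero (y := A_Y - A) hP hw
    (by rw [hP', inner_sub_left, h₁, h₂, sub_self])
    (by rw [hP', inner_sub_left]; linarith)
  obtain ⟨r, -, hr⟩ := hMr.exists_nonneg_left (sub_ne_zero.2 hYA)
  have hu : A_M - A = (r * t) • ((B - A) + (C - A)) := by rw [← hr, ht, smul_smul]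
  have ht₀ : t ≠ 0 := by
    rintro rfl
    exact hYA (sub_eq_zero.1 (by simpa using ht))
  have hu₀ : r * t ≠ 0 := fun h ↦ hMA (sub_eq_zero.1 (by simpa [h] using hu))
  rw [ht] at hY₁
  rw [hu] at hM
  have hty := smul_mul_inner_self_of_two_inner ht₀ hY₁
  have hum := smul_mul_inner_self_of_two_inner hu₀ hM
  have hsum : t + r * t = 1 := by
    apply mul_right_cancel₀ (inner_self_ne_zero (𝕜 := ℝ).2 hw)
    rw [add_mul, hty, hum, h₁, one_mul, inner_add_right, real_inner_add_add_self]
    linarith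
  have hYM : (A_Y - A) + (A_M - A) = (B - A) + (C - A) := by
    rw [ht, hu, ← add_smul, hsum, one_smul]
  have hAM : A_M = B + C - A_Y := by
    rw [← sub_eq_zero] at hYM ⊢
    rw [← hYM]
    abel
  subst hMCA hMAB hAG hAGY hAM
  simp only [midpoint_eq_smul_add]
  module
end

section
/- (Hagge circle) Let P be a point lying inside the circumcircle of triangle ABC, and let the rays AP, BP, CP meet the circumcircle again at A₁, B₁, C₁ respectively. Let A₂ be the reflection of A₁ across line BC, B₂ the reflection of B₁ across line CA, and C₂ the reflection of C₁ across line AB. Then the four points A₂, B₂, C₂, H are concyclic, where H is the orthocenter of triangle ABC. -/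
open EuclideanGeometry RealInnerProductSpace

open ComplexConjugate

/-- The complex coordinate of `X` when `O` is taken as the origin. -/
noncomputable def complexCoord (O X : Pt) : ℂ := ⟨X 0 - O 0, X 1 - O 1⟩

lemma complexCoord_injective (O : Pt) : Function.Injective (complexCoord O) := by
  intro X Y h
  obtain ⟨h0, h1⟩ := Complex.ext_iff.1 h
  simp only [complexCoord, sub_left_inj] at h0 h1
  ext i
  fin_cases i
  · exact h0
  · exact h1

lemma dist_eq_norm_complexCoord_sub (O X Y : Pt) :
    dist X Y = ‖complexCoord O X - complexCoord O Y‖ := by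
  rw [EuclideanSpace.dist_eq, Complex.norm_def, Complex.normSq_apply]
  simp only [Fin.sum_univ_two, Real.dist_eq, sq_abs, complexCoord, Complex.sub_re,
    Complex.sub_im]
  congr 1
  ring

lemma complexCoord_self (O : Pt) : complexCoord O O = 0 := by
  apply Complex.ext <;> simp [complexCoord]

lemma complexCoord_mul_conj (O X : Pt) :
    complexCoord O X * conj (complexCoord O X) = ((dist O X ^ 2 : ℝ) : ℂ) := by
  rw [dist_comm, dist_eq_norm_complexCoord_sub O, complexCoord_self, sub_zero, Complex.mul_conj,
    Complex.normSq_eq_norm_sq]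

lemma complexCoord_orthogonal {X Y Z W : Pt} (O : Pt) (h : ⟪X - Y, Z - W⟫ = 0) :
    (complexCoord O X - complexCoord O Y) * conj (complexCoord O Z - complexCoord O W) +
      conj (complexCoord O X - complexCoord O Y) * (complexCoord O Z - complexCoord O W) = 0 := by
  simp only [PiLp.inner_apply, Fin.sum_univ_two, PiLp.sub_apply, RCLike.inner_apply,
    conj_trivial] at h
  apply Complex.ext
  · simp [complexCoord]
    linear_combination 2 * h
  · simp [complexCoord]
    ring

lemma complexCoord_sub_of_smul {X Y Z W : Pt} {t : ℝ} (O : Pt) (h : t • (X - Y) = Z - W) :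
    complexCoord O Z - complexCoord O W = t * (complexCoord O X - complexCoord O Y) := by
  have h0 := congrArg (fun V : Pt => V 0) h
  have h1 := congrArg (fun V : Pt => V 1) h
  simp only [PiLp.smul_apply, PiLp.sub_apply, smul_eq_mul] at h0 h1
  apply Complex.ext
  · simp [complexCoord]
    linear_combination -h0
  · simp [complexCoord]
    linear_combination -h1

lemma complexCoord_of_midpoint_mem {X Y B C : Pt} (O : Pt)
    (h : midpoint ℝ X Y ∈ affineSpan ℝ ({B, C} : Set Pt)) :
    ∃ s : ℝ, complexCoord O X + complexCoord O Y =
      2 * (complexCoord O B + s * (complexCoord O C - complexCoord O B)) := by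
  obtain ⟨s, hs⟩ := mem_affineSpan_pair_iff_exists_lineMap_eq.1 h
  refine ⟨s, ?_⟩
  have h0 := congrArg (fun V : Pt => V 0) hs
  have h1 := congrArg (fun V : Pt => V 1) hs
  simp [AffineMap.lineMap_apply, midpoint_eq_smul_add] at h0 h1
  apply Complex.ext
  · simp [complexCoord]
    linear_combination -2 * h0
  · simp [complexCoord]
    linear_combination -2 * h1

/-- The second intersection of a chord through `p` with a circle centred at `0`. -/
lemma conj_chord_endpoint {a a₁ p k : ℂ} {t : ℝ} (ha : a * conj a = k) (ha₁ : a₁ * conj a₁ = k)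
    (ht : t ≠ 0) (h : a₁ - a = t * (p - a)) : conj a₁ * (p - a) = k - a * conj p := by
  obtain rfl : a₁ = a + t * (p - a) := by linear_combination h
  have ht' : (t : ℂ) ≠ 0 := by exact_mod_cast ht
  simp only [map_add, map_sub, map_mul, Complex.conj_ofReal] at ha₁ ⊢
  apply mul_left_cancel₀ ht'
  linear_combination ha₁ - ha + t * ha

/-- The reflection of a point in a chord `bc` of a circle centred at `0`. -/
lemma reflection_in_chord {b c x y k : ℂ} {s : ℝ} (hb : b * conj b = k) (hc : c * conj c = k)
    (hbc : b ≠ c) (hperp : (y - x) * conj (c - b) + conj (y - x) * (c - b) = 0)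
    (hmid : x + y = 2 * (b + s * (c - b))) : k * y = k * (b + c) - b * c * conj x := by
  obtain rfl : y = 2 * (b + s * (c - b)) - x := by linear_combination hmid
  have hbc' : c - b ≠ 0 := sub_ne_zero.2 hbc.symm
  simp only [map_add, map_sub, map_mul, Complex.conj_ofReal, map_ofNat] at hperp ⊢
  have key : (2 * (b + s * (c - b)) - x - b) * (conj c - conj b) =
      (conj x - conj b) * (c - b) := by
    linear_combination hperp / 2
  apply mul_left_cancel₀ hbc'
  linear_combination -b * c * key + (2 * (b + s * (c - b)) - x - b) * (b * hc - c * hb)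
    + c * (c - b) * hb

/-- The orthocenter of a triangle inscribed in a circle centred at `0`. -/
lemma orthocenter_eq_add {a b c h k : ℂ} (ha : a * conj a = k) (hb : b * conj b = k)
    (hc : c * conj c = k) (hab : a ≠ b) (hbc : b ≠ c) (hca : c ≠ a) (hk : k ≠ 0)
    (h₁ : (h - a) * conj (c - b) + conj (h - a) * (c - b) = 0)
    (h₂ : (h - b) * conj (c - a) + conj (h - b) * (c - a) = 0) : h = a + b + c := by
  obtain ⟨w, rfl⟩ : ∃ w, h = w + (a + b + c) := ⟨h - (a + b + c), by ring⟩
  simp only [map_add, map_sub] at h₁ h₂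
  have e₁ : conj w * (b * c) = k * w := by
    apply mul_left_cancel₀ (sub_ne_zero.2 hbc.symm)
    linear_combination b * c * h₁ + (-2 * b * c - w * b) * hc + (2 * b * c + w * c) * hb
  have e₂ : conj w * (a * c) = k * w := by
    apply mul_left_cancel₀ (sub_ne_zero.2 hca)
    linear_combination a * c * h₂ + (-2 * a * c - w * a) * hc + (2 * a * c + w * c) * ha
  have hc0 : c ≠ 0 := by
    rintro rfl
    exact hk (by simpa using hc.symm)
  have hw : conj w * (c * (b - a)) = 0 := by linear_combination e₁ - e₂
  have hw' : w = 0 := by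
    simpa [hc0, sub_ne_zero.2 hab.symm] using hw
  simp [hw']

/-- With `q` the isogonal conjugate of `p` in a triangle `abc` inscribed in a circle centred
at `0`, the reflection `y` in `bc` of the second intersection of `ap` with the circle is as far
from `a + b + c - q` as the orthocenter `a + b + c` is. -/
lemma norm_reflection_sub_center {a b c p q x y k : ℂ} (ha : a * conj a = k)
    (hb : b * conj b = k) (hc : c * conj c = k) (hk : k ≠ 0) (hpa : p ≠ a)
    (hp : k - p * conj p ≠ 0)
    (hq : k * (k - p * conj p) * q = conj p ^ 2 * (a * b * c)
      - k * conj p * (a * b + b * c + c * a) + k ^ 2 * (a + b + c - p))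
    (hx : conj x * (p - a) = k - a * conj p)
    (hy : k * y = k * (b + c) - b * c * conj x) :
    ‖y - (a + b + c - q)‖ = ‖q‖ := by
  have hne {z : ℂ} (hz : z * conj z = k) : z ≠ 0 := by
    rintro rfl
    exact hk (by simpa using hz.symm)
  have ha0 := hne ha
  have hb0 := hne hb
  have hc0 := hne hc
  have hkc : conj k = k := by rw [← ha]; simp [mul_comm]
  have ha' : conj a = k / a := by rw [eq_div_iff ha0, mul_comm, ha]
  have hb' : conj b = k / b := by rw [eq_div_iff hb0, mul_comm, hb]
  have hc' : conj c = k / c := by rw [eq_div_iff hc0, mul_comm, hc]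
  have hpa' : p - a ≠ 0 := sub_ne_zero.2 hpa
  have hpa'' : a * conj p - k ≠ 0 := by
    intro h
    have : conj (p - a) = 0 := by
      apply mul_left_cancel₀ ha0
      rw [map_sub]
      linear_combination h - ha
    exact hpa' ((map_eq_zero _).1 this)
  have hq' : q = (conj p ^ 2 * (a * b * c) - k * conj p * (a * b + b * c + c * a)
      + k ^ 2 * (a + b + c - p)) / (k * (k - p * conj p)) := by
    rw [eq_div_iff (mul_ne_zero hk hp), ← hq]; ring
  have hv : y - (a + b + c) = -(k * a * (p - a) + b * c * (k - a * conj p)) / (k * (p - a)) := by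
    rw [eq_div_iff (mul_ne_zero hk hpa')]
    linear_combination (p - a) * hy - b * c * hx
  have hvc := congrArg conj hv
  have hqc := congrArg conj hq'
  simp only [map_add, map_sub, map_mul, map_div₀, map_neg, map_pow, Complex.conj_conj, hkc,
    ha', hb', hc'] at hvc hqc
  have key : (y - (a + b + c)) * conj (y - (a + b + c)) + (y - (a + b + c)) * conj q
      + conj (y - (a + b + c)) * q = 0 := by
    simp only [map_add, map_sub, ha', hb', hc']
    rw [hvc, hv, hqc, hq']
    generalize conj p = p' at *
    rw [show p' - k / a = (a * p' - k) / a by field_simp, mul_comm p' p]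
    field_simp
    ring
  rw [← sq_eq_sq₀ (norm_nonneg _) (norm_nonneg _), ← Complex.normSq_eq_norm_sq,
    ← Complex.normSq_eq_norm_sq]
  apply Complex.ofReal_injective
  rw [← Complex.mul_conj, ← Complex.mul_conj]
  simp only [map_add, map_sub] at key ⊢
  linear_combination key

/-- Hagge circle: let `P` lie inside the circumcircle of `ABC`, let rays `AP`, `BP`,
`CP` meet the circumcircle again at `A₁`, `B₁`, `C₁`, and let `A₂`, `B₂`, `C₂` be the
reflections of `A₁`, `B₁`, `C₁` in the lines `BC`, `CA`, `AB` respectively. Then `A₂`,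
`B₂`, `C₂` and the orthocenter `H` are concyclic. -/
theorem stmt_15 (A B C O H P A₁ B₁ C₁ A₂ B₂ C₂ : Pt)
    (hABC : AffineIndependent ℝ ![A, B, C])
    -- O is the circumcenter of triangle ABC
    (hOA : dist O A = dist O B) (hOB : dist O B = dist O C)
    -- H is the orthocenter of triangle ABC
    (hH₁ : ⟪H - A, C - B⟫ = 0) (hH₂ : ⟪H - B, C - A⟫ = 0)
    -- P lies inside the circumcircle and is not a vertex
    (hP : dist O P < dist O A) (hPA : P ≠ A) (hPB : P ≠ B) (hPC : P ≠ C)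
    -- A₁ is the second intersection of ray AP with the circumcircle
    (hA₁ : dist O A₁ = dist O A) (hA₁r : SameRay ℝ (P - A) (A₁ - A)) (hA₁A : A₁ ≠ A)
    -- B₁ is the second intersection of ray BP with the circumcircle
    (hB₁ : dist O B₁ = dist O B) (hB₁r : SameRay ℝ (P - B) (B₁ - B)) (hB₁B : B₁ ≠ B)
    -- C₁ is the second intersection of ray CP with the circumcircle
    (hC₁ : dist O C₁ = dist O C) (hC₁r : SameRay ℝ (P - C) (C₁ - C)) (hC₁C : C₁ ≠ C)
    -- A₂ is the reflection of A₁ across line BC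
    (hA₂p : ⟪A₂ - A₁, C - B⟫ = 0) (hA₂m : midpoint ℝ A₁ A₂ ∈ affineSpan ℝ ({B, C} : Set Pt))
    -- B₂ is the reflection of B₁ across line CA
    (hB₂p : ⟪B₂ - B₁, A - C⟫ = 0) (hB₂m : midpoint ℝ B₁ B₂ ∈ affineSpan ℝ ({C, A} : Set Pt))
    -- C₂ is the reflection of C₁ across line AB
    (hC₂p : ⟪C₂ - C₁, B - A⟫ = 0) (hC₂m : midpoint ℝ C₁ C₂ ∈ affineSpan ℝ ({A, B} : Set Pt)) :
    EuclideanGeometry.Cospherical ({A₂, B₂, C₂, H} : Set Pt) := by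
  have hOC := hOA.trans hOB
  set k : ℂ := ((dist O A ^ 2 : ℝ) : ℂ) with hkdef
  have ha : complexCoord O A * conj (complexCoord O A) = k := complexCoord_mul_conj O A
  have hb : complexCoord O B * conj (complexCoord O B) = k := by
    rw [complexCoord_mul_conj, ← hOA]
  have hc : complexCoord O C * conj (complexCoord O C) = k := by
    rw [complexCoord_mul_conj, ← hOC]
  have ha₁ : complexCoord O A₁ * conj (complexCoord O A₁) = k := by
    rw [complexCoord_mul_conj, hA₁]
  have hb₁ : complexCoord O B₁ * conj (complexCoord O B₁) = k := by
    rw [complexCoord_mul_conj, hB₁, ← hOA]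
  have hc₁ : complexCoord O C₁ * conj (complexCoord O C₁) = k := by
    rw [complexCoord_mul_conj, hC₁, ← hOC]
  have hk : k ≠ 0 := by
    have : 0 < dist O A := dist_nonneg.trans_lt hP
    exact Complex.ofReal_ne_zero.2 (pow_pos this 2).ne'
  have hp : k - complexCoord O P * conj (complexCoord O P) ≠ 0 := by
    rw [complexCoord_mul_conj, sub_ne_zero]
    intro h
    exact (pow_lt_pow_left₀ hP dist_nonneg two_ne_zero).ne' (Complex.ofReal_injective h)
  have inj := complexCoord_injective O
  have hAB : complexCoord O A ≠ complexCoord O B :=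
    inj.ne fun h => by simpa using hABC.injective (a₁ := 0) (a₂ := 1) h
  have hBC : complexCoord O B ≠ complexCoord O C :=
    inj.ne fun h => by simpa using hABC.injective (a₁ := 1) (a₂ := 2) h
  have hCA : complexCoord O C ≠ complexCoord O A :=
    inj.ne fun h => by simpa using hABC.injective (a₁ := 2) (a₂ := 0) h
  have hH := orthocenter_eq_add ha hb hc hAB hBC hCA hk (complexCoord_orthogonal O hH₁)
    (complexCoord_orthogonal O hH₂)
  obtain ⟨r, hr, hrA⟩ := hA₁r.exists_pos_left (sub_ne_zero.2 hPA) (sub_ne_zero.2 hA₁A)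
  obtain ⟨s, hs, hsB⟩ := hB₁r.exists_pos_left (sub_ne_zero.2 hPB) (sub_ne_zero.2 hB₁B)
  obtain ⟨t, ht, htC⟩ := hC₁r.exists_pos_left (sub_ne_zero.2 hPC) (sub_ne_zero.2 hC₁C)
  have hxa := conj_chord_endpoint ha ha₁ hr.ne' (complexCoord_sub_of_smul O hrA)
  have hxb := conj_chord_endpoint hb hb₁ hs.ne' (complexCoord_sub_of_smul O hsB)
  have hxc := conj_chord_endpoint hc hc₁ ht.ne' (complexCoord_sub_of_smul O htC)
  obtain ⟨_, hma⟩ := complexCoord_of_midpoint_mem O hA₂m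
  obtain ⟨_, hmb⟩ := complexCoord_of_midpoint_mem O hB₂m
  obtain ⟨_, hmc⟩ := complexCoord_of_midpoint_mem O hC₂m
  have hya := reflection_in_chord hb hc hBC (complexCoord_orthogonal O hA₂p) hma
  have hyb := reflection_in_chord hc ha hCA (complexCoord_orthogonal O hB₂p) hmb
  have hyc := reflection_in_chord ha hb hAB (complexCoord_orthogonal O hC₂p) hmc
  have hpA := inj.ne hPA
  have hpB := inj.ne hPB
  have hpC := inj.ne hPC
  obtain ⟨q, hq⟩ : ∃ q, k * (k - complexCoord O P * conj (complexCoord O P)) * q =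
      conj (complexCoord O P) ^ 2 * (complexCoord O A * complexCoord O B * complexCoord O C)
      - k * conj (complexCoord O P) * (complexCoord O A * complexCoord O B
        + complexCoord O B * complexCoord O C + complexCoord O C * complexCoord O A)
      + k ^ 2 * (complexCoord O A + complexCoord O B + complexCoord O C - complexCoord O P) :=
    ⟨_, mul_div_cancel₀ _ (mul_ne_zero hk hp)⟩
  have dA := norm_reflection_sub_center ha hb hc hk hpA hp hq hxa hya
  have dB := norm_reflection_sub_center hb hc ha hk hpB hp (hq.trans (by ring)) hxb hyb
  have dC := norm_reflection_sub_center hc ha hb hk hpC hp (hq.trans (by ring)) hxc hyc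
  obtain ⟨K, hK⟩ : ∃ K : Pt, complexCoord O K =
      complexCoord O A + complexCoord O B + complexCoord O C - q := by
    generalize complexCoord O A + complexCoord O B + complexCoord O C - q = z
    exact ⟨!₂[z.re + O 0, z.im + O 1], by apply Complex.ext <;> simp [complexCoord]⟩
  refine ⟨K, ‖q‖, ?_⟩
  simp only [Set.mem_insert_iff, Set.mem_singleton_iff]
  rintro X (rfl | rfl | rfl | rfl) <;> rw [dist_eq_norm_complexCoord_sub O, hK]
  · exact dA
  · rw [← dB]
    congr 1
    ring
  · rw [← dC]
    congr 1
    ring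
  · rw [hH, sub_sub_cancel]
end

section
/- The point A_Y is the orthogonal projection of the orthocenter H of triangle ABC onto the A-median line of the triangle; that is, A_Y lies on the line through A and the midpoint M_BC of BC, and HA_Y is perpendicular to AM_BC. -/
open EuclideanGeometry RealInnerProductSpace

/-- In the plane, a vector orthogonal to `n ≠ 0` is a multiple of `n` rotated by a right angle. -/
lemma exists_smul_rotation_of_inner_eq_zero {n v : Pt} (hn : n ≠ 0) (h : ⟪n, v⟫ = 0) :
    ∃ r : ℝ, v = r • !₂[-n 1, n 0] := by
  have hpos : n 0 ^ 2 + n 1 ^ 2 ≠ 0 := by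
    intro h0
    apply hn
    ext i
    fin_cases i <;> simp <;> nlinarith [sq_nonneg (n 0), sq_nonneg (n 1)]
  simp only [PiLp.inner_apply, Fin.sum_univ_two, RCLike.inner_apply, conj_trivial] at h
  refine ⟨(v 1 * n 0 - v 0 * n 1) / (n 0 ^ 2 + n 1 ^ 2), ?_⟩
  ext i
  fin_cases i
  · simp
    field_simp
    linear_combination n 0 * h
  · simp
    field_simp
    linear_combination n 1 * h

/-- The squared form of an equality of distances to a common centre. -/
lemma inner_sub_self_eq_of_dist_eq {P X Y : Pt} (h : dist P X = dist P Y) :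
    ⟪X - P, X - P⟫ = ⟪Y - P, Y - P⟫ := by
  rw [real_inner_self_eq_norm_sq, real_inner_self_eq_norm_sq, ← dist_eq_norm, ← dist_eq_norm,
    dist_comm X, dist_comm Y, h]

/-- `A_Y` is the orthogonal projection of the orthocenter `H` of triangle `ABC` onto the
`A`-median line: `A_Y` lies on the line through `A` and the midpoint of `BC`, and
`HA_Y ⊥ AM_BC`. -/
theorem stmt_17 (A B C H A_Y P₁ P₂ : Pt)
    (hABC : AffineIndependent ℝ ![A, B, C])
    -- H is the orthocenter of triangle ABC
    (hH₁ : ⟪H - A, C - B⟫ = 0) (hH₂ : ⟪H - B, C - A⟫ = 0)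
    -- γ₁ : the circle with center P₁ through A and B, tangent to line BC at B
    (hP₁ : dist P₁ A = dist P₁ B) (hP₁t : ⟪P₁ - B, C - B⟫ = 0)
    -- γ₂ : the circle with center P₂ through A and C, tangent to line BC at C
    (hP₂ : dist P₂ A = dist P₂ C) (hP₂t : ⟪P₂ - C, B - C⟫ = 0)
    -- A_Y is the second intersection point of γ₁ and γ₂
    (hY₁ : dist P₁ A_Y = dist P₁ A) (hY₂ : dist P₂ A_Y = dist P₂ A)
    (hYA : A_Y ≠ A) :
    Collinear ℝ ({A, midpoint ℝ B C, A_Y} : Set Pt) ∧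
      ⟪H - A_Y, midpoint ℝ B C - A⟫ = 0 := by
  have hBC : C - B ≠ 0 := by
    intro h
    have := hABC.injective.ne (show (1 : Fin 3) ≠ 2 by decide)
    exact this (sub_eq_zero.mp h).symm
  have hd : 0 < ⟪C - B, C - B⟫ := real_inner_self_pos.mpr hBC
  have hP : P₁ - P₂ ≠ 0 := by
    intro h
    rw [← sub_eq_zero.mp h] at hP₂t
    have : ⟪C - B, C - B⟫ = ⟪P₁ - B, C - B⟫ + ⟪P₁ - C, B - C⟫ := by
      simp only [inner_sub_left, inner_sub_right]
      ring
    linarith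
  obtain ⟨M, hM⟩ : ∃ M, M = midpoint ℝ B C := ⟨_, rfl⟩
  have hB : B = M + M - C := by
    rw [hM, midpoint_add_self]
    abel
  rw [← hM]
  clear hM
  subst hB
  replace hP₁ := inner_sub_self_eq_of_dist_eq hP₁
  replace hP₂ := inner_sub_self_eq_of_dist_eq hP₂
  replace hY₁ := inner_sub_self_eq_of_dist_eq hY₁
  replace hY₂ := inner_sub_self_eq_of_dist_eq hY₂
  have hMA : ⟪P₁ - P₂, M - A⟫ = 0 := by
    simp only [PiLp.inner_apply, Fin.sum_univ_two, RCLike.inner_apply, conj_trivial,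
      PiLp.sub_apply, PiLp.add_apply] at *
    linarith
  have hYA' : ⟪P₁ - P₂, A_Y - A⟫ = 0 := by
    simp only [PiLp.inner_apply, Fin.sum_univ_two, RCLike.inner_apply, conj_trivial,
      PiLp.sub_apply, PiLp.add_apply] at *
    linarith
  obtain ⟨u, hu⟩ := exists_smul_rotation_of_inner_eq_zero hP hMA
  obtain ⟨s, hs⟩ := exists_smul_rotation_of_inner_eq_zero hP hYA'
  generalize (!₂[-(P₁ - P₂) 1, (P₁ - P₂) 0] : Pt) = w at hu hs
  obtain rfl : M = u • w + A := sub_eq_iff_eq_add.mp hu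
  obtain rfl : A_Y = s • w + A := sub_eq_iff_eq_add.mp hs
  have hs0 : s ≠ 0 := by
    rintro rfl
    simp at hYA
  constructor
  · rw [collinear_iff_of_mem (p₀ := A) (by simp)]
    refine ⟨w, ?_⟩
    rintro p (rfl | rfl | rfl)
    · exact ⟨0, by simp⟩
    · exact ⟨u, rfl⟩
    · exact ⟨s, rfl⟩
  · simp only [PiLp.inner_apply, Fin.sum_univ_two, RCLike.inner_apply, conj_trivial,
      PiLp.sub_apply, PiLp.add_apply, PiLp.smul_apply, smul_eq_mul] at *
    have hw : 2 * ((A 0 - P₁ 0) * w 0 + (A 1 - P₁ 1) * w 1) + s * (w 0 ^ 2 + w 1 ^ 2) = 0 := by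
      apply mul_left_cancel₀ hs0
      linear_combination hY₁
    linear_combination hH₂ - hH₁ / 2 - hP₁ - hP₁t - u * hw
end
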